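/- arXiv:2406.08280 — 2 statements merged into one kernel-verified Lean document; each statement's English description precedes it below -/
import Mathlib

section
/- Let (P,d) be a nonempty compact metric polyhedron (e.g., P = [0,1]^k) and for n ≥ 1 equip P^n with the metric d_n(x,y) = max_{1≤i≤n} d(x_i, y_i). There exists ε₀ > 0, independent of n, such that for all 0 < ε < ε₀ and all n ≥ 1, dim_ε(P^n, d_n) = n · dim(P). -/
open Set Filter Topology

/-- `covDimLE X n`: every finite open cover of `X` admits a finite open refinement
of order at most `n` (i.e. each point lies in at most `n+1` members). -/
def covDimLE (X : Type) [TopologicalSpace X] (n : ℕ) : Prop :=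
  ∀ (ι : Type) (U : ι → Set X), Finite ι → (∀ i, IsOpen (U i)) → (⋃ i, U i) = Set.univ →
    ∃ (κ : Type) (V : κ → Set X), Finite κ ∧ (∀ j, IsOpen (V j)) ∧ (⋃ j, V j) = Set.univ ∧
      (∀ j, ∃ i, V j ⊆ U i) ∧ ∀ x : X, Set.ncard {j | x ∈ V j} ≤ n + 1

/-- The topological (covering) dimension of `X`, as an element of `ENNReal`
(`⊤` if no finite bound exists). -/
noncomputable def topDim (X : Type) [TopologicalSpace X] : ENNReal :=
  sInf {d : ENNReal | ∃ n : ℕ, d = n ∧ covDimLE X n}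

/-- `ε`-injectivity of `f` with respect to a distance function `ρ` on the source. -/
def IsEpsInj {X P : Type} (ρ : X → X → ℝ) (ε : ℝ) (f : X → P) : Prop :=
  ∀ x y, f x = f y → ρ x y ≤ ε

/-- The `ε`-width dimension `dim_ε(X, ρ)`: the infimum of topological dimensions of
compact metric spaces `P` admitting an `ε`-injective continuous map `X → P`. -/
noncomputable def dimEps (X : Type) [TopologicalSpace X] (ρ : X → X → ℝ) (ε : ℝ) : ENNReal :=
  sInf {d : ENNReal | ∃ (P : Type) (_ : MetricSpace P) (f : X → P),
    CompactSpace P ∧ Continuous f ∧ IsEpsInj ρ ε f ∧ topDim P = d}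

/-- `X` is a (compact metric) polyhedron: it is homeomorphic to a finite union of
convex polytopes (convex hulls of finite sets) in some Euclidean space. -/
def IsPolyhedron (X : Type) [TopologicalSpace X] : Prop :=
  ∃ (N : ℕ) (S : Finset (Finset (Fin N → ℝ))),
    Nonempty (X ≃ₜ (⋃ s ∈ S, convexHull ℝ (s : Set (Fin N → ℝ)) : Set (Fin N → ℝ)))

set_option linter.unusedSectionVars false
set_option linter.unusedSimpArgs false

/-- cubical cup product of differentials, evaluated against an alternating map -/
def kL {ι : Type} [Fintype ι] [DecidableEq ι] : (p : ℕ) → (Fin p → (ι → ℤ) → ℤ) →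
    ((ι → ℤ) [⋀^Fin p]→ₗ[ℤ] ℤ) → (ι → ℤ) → ℤ
  | 0, _, ε, _ => ε ![]
  | p+1, a, ε, v => ∑ c : ι, (a 0 (v + Pi.single c 1) - a 0 v) *
      kL p (fun i => a i.succ) (ε.curryLeft (Pi.single c 1)) (v + Pi.single c 1)

section
variable {ι : Type} [Fintype ι] [DecidableEq ι]

lemma kL_zero (p : ℕ) (a : Fin p → (ι → ℤ) → ℤ) (v : ι → ℤ) : kL p a 0 v = 0 := by
  induction p generalizing v with
  | zero => simp [kL]
  | succ p ih => simp [kL, ih]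

lemma kL_neg (p : ℕ) (a : Fin p → (ι → ℤ) → ℤ) (ε : (ι → ℤ) [⋀^Fin p]→ₗ[ℤ] ℤ) (v : ι → ℤ) :
    kL p a (-ε) v = - kL p a ε v := by
  induction p generalizing v with
  | zero => simp [kL]
  | succ p ih =>
    have h : ∀ c : ι, (-ε).curryLeft (Pi.single c 1) = - ε.curryLeft (Pi.single c 1) := by
      intro c; ext; simp
    simp [kL, h, ih]

lemma curry_anti {p : ℕ} (ε : (ι → ℤ) [⋀^Fin (p+2)]→ₗ[ℤ] ℤ) (x y : ι → ℤ) :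
    (ε.curryLeft x).curryLeft y = - (ε.curryLeft y).curryLeft x := by
  have h := AlternatingMap.curryLeft_same ε (x + y)
  have hx := AlternatingMap.curryLeft_same ε x
  have hy := AlternatingMap.curryLeft_same ε y
  have e : (ε.curryLeft (x+y)).curryLeft (x+y) = (ε.curryLeft x).curryLeft x
    + (ε.curryLeft x).curryLeft y + (ε.curryLeft y).curryLeft x
    + (ε.curryLeft y).curryLeft y := by
    have h1 : ε.curryLeft (x+y) = ε.curryLeft x + ε.curryLeft y := map_add _ _ _
    have h2 : ∀ (η θ : (ι → ℤ) [⋀^Fin (p+1)]→ₗ[ℤ] ℤ) z, (η + θ).curryLeft z = η.curryLeft z + θ.curryLeft z := by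
      intros; ext; simp
    rw [h1, h2, map_add, map_add]; abel
  rw [h, hx, hy] at e
  rw [eq_neg_iff_add_eq_zero]
  simpa using e.symm

lemma sum_anti (F : ι → ι → ℤ) (h : ∀ c d, F c d = - F d c) : ∑ c, ∑ d, F c d = 0 := by
  have : ∑ c, ∑ d, F c d = - ∑ c, ∑ d, F c d := by
    conv_lhs => rw [Finset.sum_comm]
    rw [← Finset.sum_neg_distrib]
    refine Finset.sum_congr rfl fun c _ => ?_
    rw [← Finset.sum_neg_distrib]
    exact Finset.sum_congr rfl fun d _ => h _ _
  omega

lemma kL_closed (p : ℕ) (a : Fin p → (ι → ℤ) → ℤ) (ε : (ι → ℤ) [⋀^Fin (p+1)]→ₗ[ℤ] ℤ)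
    (v : ι → ℤ) :
    ∑ c : ι, kL p a (ε.curryLeft (Pi.single c 1)) (v + Pi.single c 1)
      = ∑ c : ι, kL p a (ε.curryLeft (Pi.single c 1)) v := by
  induction p generalizing v with
  | zero => simp [kL]
  | succ p ih =>
    set e : ι → ι → ℤ := fun c => Pi.single c 1 with he
    set a' : Fin p → (ι → ℤ) → ℤ := fun i => a i.succ
    set G : ι → ι → (ι → ℤ) → ℤ := fun c d w => kL p a' ((ε.curryLeft (e c)).curryLeft (e d)) w with hG
    have anti : ∀ c d w, G c d w = - G d c w := by
      intro c d w
      simp only [hG]; rw [curry_anti, kL_neg]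
    have IH : ∀ c w, ∑ d, G c d (w + e d) = ∑ d, G c d w := fun c w => ih a' (ε.curryLeft (e c)) w
    have l1 : ∑ c, ∑ d, a 0 (v + e c + e d) * G c d (v + e c + e d) = 0 := by
      apply sum_anti; intro c d
      rw [anti c d, add_right_comm]; ring
    have l2 : ∑ c, ∑ d, a 0 (v + e c) * G c d (v + e c + e d)
        = ∑ c, ∑ d, a 0 (v + e c) * G c d (v + e c) := by
      refine Finset.sum_congr rfl fun c _ => ?_
      rw [← Finset.mul_sum, IH, Finset.mul_sum]
    have l3 : ∑ c, ∑ d, a 0 (v + e d) * G c d (v + e d)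
        = - ∑ c, ∑ d, a 0 (v + e c) * G c d (v + e c) := by
      rw [Finset.sum_comm, ← Finset.sum_neg_distrib]
      refine Finset.sum_congr rfl fun c _ => ?_
      rw [← Finset.sum_neg_distrib]
      refine Finset.sum_congr rfl fun d _ => ?_
      rw [anti]; ring
    have l4 : ∑ c, ∑ d, a 0 v * G c d (v + e d) = 0 := by
      have : ∑ c, ∑ d, a 0 v * G c d (v + e d) = ∑ c, ∑ d, a 0 v * G c d v := by
        refine Finset.sum_congr rfl fun c _ => ?_
        rw [← Finset.mul_sum, IH, Finset.mul_sum]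
      rw [this]
      apply sum_anti; intro c d
      rw [anti c d]; ring
    have g1 : ∑ c : ι, kL (p+1) a (ε.curryLeft (e c)) (v + e c)
       = ∑ c, ∑ d, a 0 (v + e c + e d) * G c d (v + e c + e d)
        - ∑ c, ∑ d, a 0 (v + e c) * G c d (v + e c + e d) := by
      simp only [kL, ← Finset.sum_sub_distrib, ← sub_mul]; rfl
    have g2 : ∑ c : ι, kL (p+1) a (ε.curryLeft (e c)) v
       = ∑ c, ∑ d, a 0 (v + e d) * G c d (v + e d)
        - ∑ c, ∑ d, a 0 v * G c d (v + e d) := by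
      simp only [kL, ← Finset.sum_sub_distrib, ← sub_mul]; rfl
    rw [g1, g2, l1, l2, l3, l4]; ring

lemma kL_vanish (p : ℕ) (a : Fin p → (ι → ℤ) → ℤ) (ε : (ι → ℤ) [⋀^Fin p]→ₗ[ℤ] ℤ)
    (v : ι → ℤ) (c : ι) (i : Fin p) (K : ℤ) (hi : ∀ w, w c = v c → a i w = K)
    (hε : ∀ x : Fin p → (ι → ℤ), (∃ j, x j = Pi.single c 1) → ε x = 0) : kL p a ε v = 0 := by
  induction p generalizing v with
  | zero => exact i.elim0
  | succ p ih =>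
    simp only [kL]
    refine Finset.sum_eq_zero fun d _ => ?_
    by_cases hd : d = c
    · subst hd
      have : ε.curryLeft (Pi.single d 1) = 0 := by
        ext x; simp only [AlternatingMap.curryLeft_apply_apply, AlternatingMap.zero_apply]
        exact hε _ ⟨0, by simp⟩
      rw [this, kL_zero, mul_zero]
    · have hv : (v + Pi.single d 1 : ι → ℤ) c = v c := by
        simp [Pi.single_apply, Ne.symm hd]
      rcases Fin.eq_zero_or_eq_succ i with rfl | ⟨j, rfl⟩
      · rw [hi _ hv, hi _ rfl]; simp
      · rw [ih (fun i => a i.succ) _ _ j (fun w hw => hi w (hw.trans hv)), mul_zero]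
        rintro x ⟨j, hj⟩
        simp only [AlternatingMap.curryLeft_apply_apply]
        exact hε _ ⟨j.succ, by simpa using hj⟩

lemma tele (M : ℕ) (f : ℤ → ℤ) : ∑ k ∈ Finset.Ico (0:ℤ) M, (f (k+1) - f k) = f M - f 0 := by
  induction M with
  | zero => simp
  | succ M ih =>
    have : Finset.Ico (0:ℤ) ((M+1 : ℕ):ℤ) = insert (M:ℤ) (Finset.Ico (0:ℤ) M) := by
      ext x; simp only [Finset.mem_Ico, Finset.mem_insert]; push_cast; omega
    rw [this, Finset.sum_insert (by simp), ih]; push_cast; ring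

/-- the box -/
noncomputable def kBox (M : ℕ) (S : Finset ι) : Finset (ι → ℤ) :=
  Fintype.piFinset fun c => if c ∈ S then Finset.Ico (0:ℤ) M else {(M:ℤ)}

lemma sum_box (M : ℕ) (S : Finset ι) (c : ι) (hc : c ∈ S) (f : (ι → ℤ) → ℤ) :
    ∑ v ∈ kBox M S, f v = ∑ w ∈ kBox M (S.erase c), ∑ k ∈ Finset.Ico (0:ℤ) M,
      f (Function.update w c k) := by
  rw [← Finset.sum_product']
  symm
  refine Finset.sum_bij' (fun x _ => Function.update x.1 c x.2)
    (fun v _ => (Function.update v c M, v c)) ?_ ?_ ?_ ?_ ?_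
  · rintro ⟨w, k⟩ h
    simp only [Finset.mem_product, kBox, Fintype.mem_piFinset] at h ⊢
    intro d
    by_cases hd : d = c
    · subst hd; simpa [hc] using h.2
    · simpa [hd] using h.1 d
  · intro v h
    simp only [Finset.mem_product, kBox, Fintype.mem_piFinset] at h ⊢
    refine ⟨fun d => ?_, by simpa [hc] using h c⟩
    by_cases hd : d = c
    · subst hd; simp
    · simpa [hd] using h d
  · rintro ⟨w, k⟩ h
    simp only [Finset.mem_product, kBox, Fintype.mem_piFinset] at h ⊢
    have := h.1 c
    simp at this
    simp [← this]
  · intro v h; simp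
  · intros; rfl

lemma kL_total (M : ℕ) (p : ℕ) (a : Fin p → (ι → ℤ) → ℤ) (d : Fin p → ι)
    (hd : Function.Injective d) (h0 : ∀ i (v : ι → ℤ), v (d i) = 0 → a i v = 0)
    (h1 : ∀ i (v : ι → ℤ), v (d i) = M → a i v = 1)
    (ε : (ι → ℤ) [⋀^Fin p]→ₗ[ℤ] ℤ)
    (hε : ∀ c, c ∉ Finset.univ.image d → ∀ x : Fin p → (ι → ℤ), (∃ j, x j = Pi.single c 1) → ε x = 0) :
    ∑ v ∈ kBox M (Finset.univ.image d), kL p a ε v = ε (fun i => Pi.single (d i) 1) := by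
  induction p with
  | zero =>
    have : kBox M (Finset.univ.image d) = {fun _ : ι => (M : ℤ)} := by
      ext v; simp [kBox, Fintype.mem_piFinset, funext_iff]
    rw [this]; simp [kL]; congr 1; ext i; exact i.elim0
  | succ p ih =>
    set S := Finset.univ.image d with hS
    set a' : Fin p → (ι → ℤ) → ℤ := fun i => a i.succ with ha'
    set g : ι → (ι → ℤ) → ℤ := fun c v => a 0 v * kL p a' (ε.curryLeft (Pi.single c 1)) v with hg
    have s1 : ∀ v, kL (p+1) a ε v = ∑ c, (g c (v + Pi.single c 1) - g c v) := by
      intro v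
      simp only [kL, hg, sub_mul, Finset.sum_sub_distrib, ← Finset.mul_sum]
      rw [kL_closed p a' ε v]
    simp only [s1]
    rw [Finset.sum_comm]
    have s2 : ∀ c ∈ S, ∑ v ∈ kBox M S, (g c (v + Pi.single c 1) - g c v)
        = ∑ w ∈ kBox M (S.erase c), (g c w - g c (Function.update w c 0)) := by
      intro c hc
      rw [sum_box M S c hc]
      refine Finset.sum_congr rfl fun w hw => ?_
      have : ∀ k : ℤ, Function.update w c k + Pi.single c 1 = Function.update w c (k+1) := by
        intro k; ext x
        by_cases hx : x = c
        · subst hx; simp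
        · simp [hx]
      simp only [this]
      rw [tele M (fun k => g c (Function.update w c k))]
      have hwc : w c = M := by
        have := (Fintype.mem_piFinset.1 hw) c
        simpa using this
      rw [← hwc, Function.update_eq_self]
    have hnot : ∀ c x, (∃ j, x j = Pi.single c 1) → ε.curryLeft (Pi.single c 1) x = 0 := by
      rintro c x ⟨j, hj⟩
      rw [AlternatingMap.curryLeft_apply_apply]
      exact AlternatingMap.map_eq_zero_of_eq _ _ (i := 0) (j := j.succ) (by simp [hj])
        (Fin.succ_ne_zero j).symm
    rw [Finset.sum_eq_single (d 0)]
    · rw [s2 _ (by simp [hS])]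
      have hS' : S.erase (d 0) = Finset.univ.image (fun i : Fin p => d i.succ) := by
        ext x
        simp only [hS, Finset.mem_erase, Finset.mem_image, Finset.mem_univ, true_and]
        constructor
        · rintro ⟨hx, i, rfl⟩
          rcases Fin.eq_zero_or_eq_succ i with rfl | ⟨j, rfl⟩
          · exact absurd rfl hx
          · exact ⟨j, rfl⟩
        · rintro ⟨i, rfl⟩
          exact ⟨fun h => Fin.succ_ne_zero i (hd h), _, rfl⟩
      have : ∀ w ∈ kBox M (S.erase (d 0)), (g (d 0) w - g (d 0) (Function.update w (d 0) 0))
          = kL p a' (ε.curryLeft (Pi.single (d 0) 1)) w := by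
        intro w hw
        have hwc : w (d 0) = M := by
          have := (Fintype.mem_piFinset.1 hw) (d 0)
          simpa using this
        simp only [hg]
        rw [h1 0 w hwc, h0 0 (Function.update w (d 0) 0) (by simp)]; ring
      rw [Finset.sum_congr rfl this, hS', ih a' (fun i => d i.succ)
        (fun i j h => Fin.succ_injective _ (hd h)) (fun i => h0 i.succ) (fun i => h1 i.succ)]
      · rw [AlternatingMap.curryLeft_apply_apply]
        congr 1; ext i; refine Fin.cases ?_ (fun j => ?_) i <;> simp
      · rw [← hS']
        intro c hc x hx
        by_cases hc0 : c = d 0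
        · subst hc0; exact hnot _ x hx
        · have : c ∉ S := fun h => hc (Finset.mem_erase.2 ⟨hc0, h⟩)
          rw [AlternatingMap.curryLeft_apply_apply]
          obtain ⟨j, hj⟩ := hx
          exact hε c this _ ⟨j.succ, by simpa using hj⟩
    · intro c _ hc0
      by_cases hc : c ∈ S
      · rw [s2 c hc]
        refine Finset.sum_eq_zero fun w hw => ?_
        have hwc : w c = M := by
          have := (Fintype.mem_piFinset.1 hw) c
          simpa using this
        obtain ⟨i, -, hi⟩ := Finset.mem_image.1 hc
        rcases Fin.eq_zero_or_eq_succ i with rfl | ⟨j, rfl⟩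
        · exact absurd hi.symm hc0
        subst hi
        simp only [hg]
        rw [kL_vanish p a' _ w (d j.succ) j 1 (fun u hu => h1 _ _ (hu.trans hwc)) (hnot _),
          kL_vanish p a' _ (Function.update w (d j.succ) 0) (d j.succ) j 0
            (fun u hu => h0 _ _ (hu.trans (by simp))) (hnot _)]
        simp
      · have : ε.curryLeft (Pi.single c 1) = 0 := by
          ext x; simp only [AlternatingMap.curryLeft_apply_apply, AlternatingMap.zero_apply]
          exact hε c hc _ ⟨0, by simp⟩
        simp only [hg, this, kL_zero]; simp
    · simp

/-- lattice path -/
def kPath {p : ℕ} (f : Fin p → ι) (v : ι → ℤ) (k : Fin (p+1)) : ι → ℤ :=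
  v + ∑ j : Fin p, if j.castSucc < k then Pi.single (f j) 1 else 0

lemma kPath_zero {p : ℕ} (f : Fin p → ι) (v : ι → ℤ) : kPath f v 0 = v := by
  simp [kPath]

lemma kPath_succ {p : ℕ} (c : ι) (f : Fin p → ι) (v : ι → ℤ) (k : Fin (p+1)) :
    kPath (Fin.cons c f : Fin (p+1) → ι) v k.succ = kPath f (v + Pi.single c 1) k := by
  simp only [kPath, Fin.sum_univ_succ, add_assoc, ← Fin.succ_castSucc, Fin.castSucc_zero,
    Fin.succ_pos, Fin.succ_lt_succ_iff, if_true, Fin.cons_zero, Fin.cons_succ]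

lemma kPath_dist {p : ℕ} (f : Fin p → ι) (v : ι → ℤ) (k : Fin (p+1)) (c : ι) :
    v c ≤ kPath f v k c ∧ kPath f v k c ≤ v c + p := by
  simp only [kPath, Pi.add_apply, Finset.sum_apply]
  have h : ∀ j : Fin p, 0 ≤ (if j.castSucc < k then (Pi.single (f j) 1 : ι → ℤ) else 0) c ∧
     (if j.castSucc < k then (Pi.single (f j) 1 : ι → ℤ) else 0) c ≤ 1 := by
    intro j
    split_ifs
    · rw [Pi.single_apply]; split_ifs <;> simp
    · simp
  constructor
  · have := Finset.sum_nonneg (fun j (_ : j ∈ Finset.univ) => (h j).1)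
    linarith
  · have := Finset.sum_le_sum (fun j (_ : j ∈ Finset.univ) => (h j).2)
    simp only [Finset.sum_const, Finset.card_univ, Fintype.card_fin, nsmul_eq_mul, mul_one] at this
    linarith

lemma kL_explicit (p : ℕ) (a : Fin p → (ι → ℤ) → ℤ) (ε : (ι → ℤ) [⋀^Fin p]→ₗ[ℤ] ℤ) (v : ι → ℤ) :
    kL p a ε v = ∑ f : Fin p → ι, ε (fun i => Pi.single (f i) 1) *
      ∏ i : Fin p, (a i (kPath f v i.succ) - a i (kPath f v i.castSucc)) := by
  induction p generalizing v with
  | zero =>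
    simp only [kL, Finset.univ_eq_empty, Finset.prod_empty, mul_one]
    rw [Fintype.sum_unique]; congr 1; ext i; exact i.elim0
  | succ p ih =>
    rw [← (Fin.consEquiv (fun _ : Fin (p+1) => ι)).sum_comp, Fintype.sum_prod_type]
    simp only [kL]
    refine Finset.sum_congr rfl fun c _ => ?_
    rw [ih, Finset.mul_sum]
    refine Finset.sum_congr rfl fun f _ => ?_
    have e0 : (Fin.consEquiv (fun _ : Fin (p+1) => ι)) (c, f) = (Fin.cons c f : Fin (p+1) → ι) := rfl
    rw [e0]
    simp only [Fin.prod_univ_succ, Fin.castSucc_zero, kPath_zero, kPath_succ, ← Fin.succ_castSucc]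
    have e1 : (fun i => Pi.single ((Fin.cons c f : Fin (p+1) → ι) i) (1:ℤ) : Fin (p+1) → ι → ℤ)
       = Matrix.vecCons (Pi.single c 1) (fun i => Pi.single (f i) 1) := by
      ext i; refine Fin.cases ?_ (fun j => ?_) i <;> simp
    rw [e1, AlternatingMap.curryLeft_apply_apply]
    ring

lemma tele_fin (m : ℕ) (p q : Fin (m+1)) (hpq : p < q) (F : Fin (m+1) → ℤ) :
    ∑ i : Fin m, (F i.succ - F i.castSucc) * (if p ≤ i.castSucc ∧ i.succ ≤ q then 1 else 0)
      = F q - F p := by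
  let G : ℕ → ℤ := fun n => F ⟨min (max n p) q, by omega⟩
  have h : ∀ i : Fin m, (F i.succ - F i.castSucc) *
      (if p ≤ i.castSucc ∧ i.succ ≤ q then 1 else 0) = G (i+1) - G i := by
    intro i
    simp only [Fin.le_def, Fin.val_castSucc, Fin.val_succ, G]
    have hpq' : (p:ℕ) < q := hpq
    split_ifs with hc
    · rw [mul_one]
      congr 2 <;> ext <;> simp <;> omega
    · rw [mul_zero, eq_comm, sub_eq_zero]
      congr 1; ext; simp; omega
  rw [Finset.sum_congr rfl (fun i _ => h i), Fin.sum_univ_eq_sum_range (fun i => G (i+1) - G i) m,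
    Finset.sum_range_sub]
  have hpq' : (p:ℕ) < q := hpq
  simp only [G]
  congr 2 <;> ext <;> simp <;> omega

theorem grid_lemma (m M : ℕ) (a : Fin m → (Fin m → ℤ) → ℤ)
    (h0 : ∀ i (v : Fin m → ℤ), v i = 0 → a i v = 0)
    (h1 : ∀ i (v : Fin m → ℤ), v i = M → a i v = 1) :
    ∃ (v : Fin m → ℤ) (w : Fin (m+1) → Fin m → ℤ),
      (∀ k c, v c ≤ w k c ∧ w k c ≤ v c + m) ∧
      Function.Injective (fun k => (fun i => a i (w k))) := by
  by_contra hcon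
  push Not at hcon
  have hdet : ∀ (v : Fin m → ℤ) (f : Fin m → Fin m),
      Matrix.det (Matrix.of fun k i => a k (kPath f v i.succ) - a k (kPath f v i.castSucc)) = 0 := by
    intro v f
    have := hcon v (kPath f v) (kPath_dist f v)
    simp only [Function.Injective, not_forall] at this
    obtain ⟨p, q, hpq, hne⟩ := this
    wlog hlt : p < q generalizing p q
    · exact this q p hpq.symm (Ne.symm hne) (lt_of_le_of_ne (not_lt.1 hlt) (Ne.symm hne))
    rw [← Matrix.exists_mulVec_eq_zero_iff]
    refine ⟨fun i => if p ≤ i.castSucc ∧ i.succ ≤ q then 1 else 0, ?_, ?_⟩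
    · intro h
      have := congrFun h ⟨p, by have := q.2; have : (p:ℕ) < q := hlt; omega⟩
      simp only [Fin.le_def, Fin.val_castSucc, Fin.val_succ, Pi.zero_apply] at this
      rw [if_pos ⟨le_refl _, hlt⟩] at this
      exact one_ne_zero this
    · ext k
      simp only [Matrix.mulVec, dotProduct, Matrix.of_apply, Pi.zero_apply]
      rw [tele_fin m p q hlt (fun j => a k (kPath f v j))]
      have := congrFun hpq k
      rw [sub_eq_zero]; exact this.symm
  have htot : ∀ σ : Equiv.Perm (Fin m), ∑ v ∈ kBox M (Finset.univ : Finset (Fin m)),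
      kL m (fun i => a (σ i)) Matrix.detRowAlternating v = Equiv.Perm.sign σ := by
    intro σ
    have himg : (Finset.univ : Finset (Fin m)).image σ = Finset.univ := by
      ext x; simp
    have := kL_total M m (fun i => a (σ i)) σ σ.injective (fun i => h0 _) (fun i => h1 _)
      Matrix.detRowAlternating (by intro c hc; simp at hc)
    rw [himg] at this
    rw [this]
    have e : (fun i => Pi.single (σ i) 1 : Fin m → Fin m → ℤ) = (fun i => Pi.single i 1) ∘ σ := rfl
    rw [e, AlternatingMap.map_perm]
    have : Matrix.detRowAlternating (R := ℤ) (fun i : Fin m => (Pi.single i 1 : Fin m → ℤ)) = 1 := by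
      have : (fun i : Fin m => (Pi.single i 1 : Fin m → ℤ)) = (1 : Matrix (Fin m) (Fin m) ℤ) := by
        ext i j; simp [Matrix.one_apply, Pi.single_apply, eq_comm]
      rw [this]; exact Matrix.det_one
    rw [this]; simp [Units.smul_def]
  have hsum : ∑ σ : Equiv.Perm (Fin m), (Equiv.Perm.sign σ : ℤ) *
      ∑ v ∈ kBox M (Finset.univ : Finset (Fin m)),
      kL m (fun i => a (σ i)) Matrix.detRowAlternating v = 0 := by
    simp only [kL_explicit, Finset.mul_sum]
    rw [Finset.sum_comm]
    refine Finset.sum_eq_zero fun v _ => ?_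
    rw [Finset.sum_comm]
    refine Finset.sum_eq_zero fun f _ => ?_
    have := hdet v f
    rw [Matrix.det_apply'] at this
    simp only [Matrix.of_apply] at this
    simp only [mul_left_comm ((Equiv.Perm.sign _ : ℤˣ) : ℤ)]
    rw [← Finset.mul_sum]
    refine mul_eq_zero_of_right _ (Eq.trans ?_ this)
    exact Finset.sum_congr rfl fun σ _ => by simp
  simp only [htot] at hsum
  have h2 : ∀ σ : Equiv.Perm (Fin m), (Equiv.Perm.sign σ : ℤ) * (Equiv.Perm.sign σ : ℤ) = 1 := by
    intro σ; rw [← Units.val_mul, Int.units_mul_self]; rfl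
  simp only [h2] at hsum
  simp [Fintype.card_perm, Nat.factorial_ne_zero] at hsum
end

theorem lebesgue_cover (m : ℕ) (κ : Type) [Finite κ] (V : κ → Set (Fin m → unitInterval))
    (hV : ∀ j, IsOpen (V j)) (hc : (⋃ j, V j) = Set.univ)
    (hopp : ∀ j i x y, x ∈ V j → y ∈ V j → x i = 0 → y i = 1 → False) :
    ∃ x, m + 1 ≤ Set.ncard {j | x ∈ V j} := by
  classical
  obtain ⟨δ, hδ, hb⟩ := lebesgue_number_lemma_of_metric (s := Set.univ) isCompact_univ hV hc.ge
  obtain ⟨M, hM⟩ := exists_nat_gt (((m:ℝ) + 1) / δ)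
  have hM0 : (0:ℝ) < M := lt_trans (by positivity) hM
  let X : (Fin m → ℤ) → (Fin m → unitInterval) := fun v c =>
    Set.projIcc (0:ℝ) 1 zero_le_one ((v c : ℝ) / M)
  choose J hJ using fun x => hb x (Set.mem_univ x)
  let a : Fin m → (Fin m → ℤ) → ℤ := fun i v => if ∃ y ∈ V (J (X v)), y i = 1 then 1 else 0
  have hmem : ∀ v, X v ∈ V (J (X v)) := fun v => hJ _ (Metric.mem_ball_self hδ)
  obtain ⟨v, w, hw, hinj⟩ := grid_lemma m M a
    (by
      intro i v hv
      have hx : X v i = 0 := by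
        simp only [X, hv]; simp
      simp only [a]
      rw [if_neg]
      rintro ⟨y, hy, hy1⟩
      exact hopp _ i _ y (hmem v) hy hx hy1)
    (by
      intro i v hv
      have hx : X v i = 1 := by
        simp only [X, hv]
        have : (((M:ℤ):ℝ)) / (M:ℝ) = 1 := by push_cast; exact div_self hM0.ne'
        rw [this]
        exact Set.projIcc_right zero_le_one
      simp only [a]
      rw [if_pos ⟨X v, hmem v, hx⟩])
  refine ⟨X v, ?_⟩
  have hin : ∀ k, X v ∈ V (J (X (w k))) := by
    intro k
    apply hJ
    rw [Metric.mem_ball, dist_pi_lt_iff hδ]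
    intro c
    have h1 : dist (X v c) (X (w k) c) ≤ |(v c : ℝ) / M - (w k c : ℝ) / M| := by
      have := abs_projIcc_sub_projIcc (α := ℝ) (a := 0) (b := 1) (c := (v c : ℝ) / M)
        (d := (w k c : ℝ) / M) zero_le_one
      exact this
    refine lt_of_le_of_lt h1 ?_
    rw [← sub_div, abs_div, abs_of_pos hM0, div_lt_iff₀ hM0]
    obtain ⟨ha, hb⟩ := hw k c
    have ha' : (v c : ℝ) ≤ w k c := by exact_mod_cast ha
    have hb' : (w k c : ℝ) ≤ v c + m := by exact_mod_cast hb
    have : |(v c : ℝ) - w k c| ≤ m := by rw [abs_le]; constructor <;> linarith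
    rw [div_lt_iff₀ hδ] at hM
    linarith
  have hJinj : Function.Injective (fun k => J (X (w k))) := by
    intro k l hkl
    apply hinj
    funext i
    simp only at hkl
    simp only [a, hkl]
  have hsub : Set.range (fun k => J (X (w k))) ⊆ {j | X v ∈ V j} := by
    rintro _ ⟨k, rfl⟩; exact hin k
  calc m + 1 = Nat.card (Fin (m+1)) := by simp
    _ = Set.ncard (Set.range (fun k => J (X (w k)))) := by
        rw [← Set.image_univ, Set.ncard_image_of_injective _ hJinj, Set.ncard_univ]
    _ ≤ _ := Set.ncard_le_ncard hsub (Set.toFinite _)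

theorem dim_lower (m : ℕ) (Q : Type) [MetricSpace Q] [CompactSpace Q]
    (g : (Fin m → unitInterval) → Q) (hg : Continuous g)
    (hopp : ∀ i x y, x i = 0 → y i = 1 → g x ≠ g y) (j : ℕ) (hj : covDimLE Q j) : m ≤ j := by
  let F : Fin m → Bool → Set (Fin m → unitInterval) := fun i b => {x | x i = if b then 1 else 0}
  have hF : ∀ i b, IsClosed (F i b) := fun i b => isClosed_eq (continuous_apply i) continuous_const
  have hgF : ∀ i b, IsClosed (g '' F i b) := fun i b => ((hF i b).isCompact.image hg).isClosed
  obtain ⟨κ, V, hfin, hV, hVc, hVr, hVo⟩ := hj (Fin m → Bool)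
    (fun s => ⋂ i, (g '' F i (s i))ᶜ) inferInstance
    (fun s => isOpen_iInter_of_finite fun i => (hgF i (s i)).isOpen_compl)
    (by
      rw [Set.eq_univ_iff_forall]
      intro q
      have : ∀ i, ∃ b, q ∉ g '' F i b := by
        intro i
        by_contra hcon
        push Not at hcon
        obtain ⟨x, hx, hxq⟩ := hcon false
        obtain ⟨y, hy, hyq⟩ := hcon true
        exact hopp i x y (by simpa [F] using hx) (by simpa [F] using hy) (hxq.trans hyq.symm)
      choose s hs using this
      exact Set.mem_iUnion.2 ⟨s, Set.mem_iInter.2 hs⟩)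
  obtain ⟨x, hx⟩ := lebesgue_cover m κ (fun k => g ⁻¹' V k) (fun k => (hV k).preimage hg)
    (by rw [← Set.preimage_iUnion, hVc, Set.preimage_univ])
    (by
      intro k i x y hx hy hx0 hy1
      obtain ⟨s, hs⟩ := hVr k
      rcases h : s i with _ | _
      · have := Set.mem_iInter.1 (hs hx) i
        rw [h] at this
        exact this ⟨x, by simpa [F] using hx0, rfl⟩
      · have := Set.mem_iInter.1 (hs hy) i
        rw [h] at this
        exact this ⟨y, by simpa [F] using hy1, rfl⟩)
  have := hVo (g x)
  simp only [Set.mem_preimage] at hx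
  omega

lemma generic_shift {ι : Type} [Fintype ι] [DecidableEq ι] {T : Type} [Finite T] (m : ℕ)
    (p : T → ι → ℝ) (D : T → Submodule ℝ (ι → ℝ)) (hD : ∀ t, Module.finrank ℝ (D t) ≤ m)
    (η : ℝ) (hη : 0 < η) :
    ∃ s : ι → ℝ, ∀ t, ∀ d ∈ D t, ∀ z : ι → ℤ, ∀ C : Finset ι,
      (∀ c ∈ C, (p t + d) c = η * (s c + z c)) → C.card ≤ m := by
  classical
  by_contra hcon
  push Not at hcon
  let Lin : (C : Finset ι) → (ι → ℝ) →ₗ[ℝ] (C → ℝ) := fun C => LinearMap.funLeft ℝ ℝ (fun c : C => (c : ι))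
  let h : (C : Finset ι) → (ι → ℤ) → (ι → ℝ) →ᵃ[ℝ] (C → ℝ) := fun C z =>
    (Lin C).toAffineMap.comp (η • AffineMap.id ℝ (ι → ℝ) + AffineMap.const ℝ (ι → ℝ) (fun c => η * (z c : ℝ)))
  let A : T → AffineSubspace ℝ (ι → ℝ) := fun t => AffineSubspace.mk' (p t) (D t)
  let B : T × (ι → ℤ) × {C : Finset ι // m < C.card} → AffineSubspace ℝ (ι → ℝ) := fun x =>
    ((A x.1).map (Lin x.2.2.1).toAffineMap).comap (h x.2.2.1 x.2.1)
  have hB : ∀ x, B x ≠ ⊤ := by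
    rintro ⟨t, z, C, hC⟩ htop
    have hsurj : Function.Surjective (h C z) := by
      intro y
      refine ⟨fun c => if hc : c ∈ C then y ⟨c, hc⟩ / η - z c else 0, ?_⟩
      ext c
      simp [h, Lin, LinearMap.funLeft_apply]
      field_simp
      ring
    have h2 : (A t).map (Lin C).toAffineMap = ⊤ := by
      rw [eq_top_iff]
      intro y _
      obtain ⟨s, rfl⟩ := hsurj y
      have : s ∈ B (t, z, ⟨C, hC⟩) := by rw [htop]; trivial
      exact AffineSubspace.mem_comap.1 this
    have h3 := congrArg AffineSubspace.direction h2
    rw [AffineSubspace.map_direction, AffineSubspace.direction_top,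
      AffineSubspace.direction_mk'] at h3
    have h4 : Module.finrank ℝ ((D t).map (Lin C).toAffineMap.linear) ≤ m :=
      (Submodule.finrank_map_le _ _).trans (hD t)
    rw [h3, finrank_top, Module.finrank_fintype_fun_eq_card, Fintype.card_coe] at h4
    omega
  have hnull : MeasureTheory.volume (⋃ x, (B x : Set (ι → ℝ))) = 0 :=
    MeasureTheory.measure_iUnion_null fun x =>
      MeasureTheory.Measure.addHaar_affineSubspace _ _ (hB x)
  have huniv : (⋃ x, (B x : Set (ι → ℝ))) = Set.univ := by
    rw [Set.eq_univ_iff_forall]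
    intro s
    obtain ⟨t, d, hd, z, C, hC, hcard⟩ := hcon s
    refine Set.mem_iUnion.2 ⟨(t, z, ⟨C, hcard⟩), ?_⟩
    change s ∈ B _
    refine AffineSubspace.mem_comap.2 ((AffineSubspace.mem_map).2 ⟨p t + d, ?_, ?_⟩)
    · change p t + d ∈ AffineSubspace.mk' (p t) (D t)
      rw [AffineSubspace.mem_mk']; simpa using hd
    · ext c
      have := hC c c.2
      simp [h, Lin, LinearMap.funLeft_apply]
      simp at this
      rw [this]; ring
  rw [huniv] at hnull
  exact (isOpen_univ.measure_pos MeasureTheory.volume Set.univ_nonempty).ne' hnull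

theorem dim_upper {ι : Type} [Fintype ι] [DecidableEq ι] {T : Type} [Finite T] (m : ℕ)
    (p : T → ι → ℝ) (D : T → Submodule ℝ (ι → ℝ)) (hD : ∀ t, Module.finrank ℝ (D t) ≤ m)
    (X : Type) [TopologicalSpace X] [CompactSpace X] (φ : X → ι → ℝ) (hφ : IsEmbedding φ)
    (hr : ∀ x, ∃ t, ∃ d ∈ D t, φ x = p t + d) : covDimLE X m := by
  classical
  intro ι' U _ hU hUc
  have : ∀ i, ∃ W, IsOpen W ∧ φ ⁻¹' W = U i := fun i => hφ.isOpen_iff.1 (hU i)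
  choose W hW hWU using this
  obtain ⟨δ, hδ, hb⟩ := lebesgue_number_lemma_of_metric (s := Set.range φ)
    (isCompact_range hφ.continuous) hW (by
      rintro _ ⟨x, rfl⟩
      have : x ∈ ⋃ i, U i := by rw [hUc]; trivial
      obtain ⟨i, hi⟩ := Set.mem_iUnion.1 this
      rw [← hWU i] at hi
      exact Set.mem_iUnion.2 ⟨i, hi⟩)
  set η := δ / 2 with hη
  have hη0 : 0 < η := by positivity
  obtain ⟨s, hs⟩ := generic_shift m p D hD η hη0
  -- cell map
  let y : (ι → ℝ) → ι → ℝ := fun x c => x c / η - s c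
  let cell : X → ι → ℤ × ℤ := fun x c => (⌊y (φ x) c⌋, ⌈y (φ x) c⌉)
  let r : (ι → ℤ × ℤ) → ℕ := fun σ => (Finset.univ.filter fun c => (σ c).1 = (σ c).2).card
  have hrm : ∀ x, r (cell x) ≤ m := by
    intro x
    obtain ⟨t, d, hd, hx⟩ := hr x
    refine hs t d hd (fun c => ⌊y (φ x) c⌋) _ ?_
    intro c hc
    simp only [Finset.mem_filter, Finset.mem_univ, true_and, cell] at hc
    have h1 : (⌊y (φ x) c⌋ : ℝ) = y (φ x) c := by
      apply le_antisymm (Int.floor_le _)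
      rw [hc]; exact Int.le_ceil _
    rw [← hx, h1]
    simp only [y]; field_simp; ring
  have hfin : (Set.range cell).Finite := by
    obtain ⟨R, hR⟩ := (isCompact_range (hφ.continuous)).isBounded.exists_norm_le
    have hyb : ∀ x c, |y (φ x) c| ≤ R / η + |s c| := by
      intro x c
      have h1 : |φ x c| ≤ R := (norm_le_pi_norm (φ x) c).trans (hR _ ⟨x, rfl⟩)
      simp only [y]
      refine (abs_sub _ _).trans ?_
      rw [abs_div, abs_of_pos hη0]
      gcongr
    refine (Set.Finite.pi' (t := fun c => (Set.Icc ⌊-(R / η + |s c|)⌋ ⌈R / η + |s c|⌉) ×ˢ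
      (Set.Icc ⌊-(R / η + |s c|)⌋ ⌈R / η + |s c|⌉))
      (fun c => (Set.finite_Icc _ _).prod (Set.finite_Icc _ _))).subset ?_
    rintro _ ⟨x, rfl⟩ c
    have := abs_le.1 (hyb x c)
    have hfc : ⌊y (φ x) c⌋ ≤ ⌈y (φ x) c⌉ := Int.floor_le_ceil _
    have h1 := Int.floor_mono this.1
    have h2 := Int.ceil_mono this.2
    exact ⟨⟨h1, hfc.trans h2⟩, ⟨h1.trans hfc, h2⟩⟩
  let Z : (ι → ℤ × ℤ) → Set (ι → ℝ) := fun σ => φ '' {x | cell x = σ}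
  -- closure property
  have hclos : ∀ (σ : ι → ℤ × ℤ) x, x ∈ closure (Z σ) →
      ∀ c, ((σ c).1 : ℝ) ≤ y x c ∧ y x c ≤ (σ c).2 := by
    intro σ x hx c
    have hcy : Continuous fun x => y x c := by
      simp only [y]; fun_prop
    have hcl : IsClosed {x | ((σ c).1 : ℝ) ≤ y x c ∧ y x c ≤ (σ c).2} :=
      (isClosed_le continuous_const hcy).inter (isClosed_le hcy continuous_const)
    refine closure_minimal ?_ hcl hx
    rintro _ ⟨x, hx, rfl⟩
    have hx' : cell x = σ := hx
    subst hx'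
    exact ⟨Int.floor_le _, Int.le_ceil _⟩
  have hsep : ∀ x (τ : ι → ℤ × ℤ), τ ∈ Set.range cell → r τ = r (cell x) → τ ≠ cell x →
      φ x ∉ closure (Z τ) := by
    rintro x _ ⟨x', rfl⟩ hrr hne hx
    apply hne
    have h := hclos _ _ hx
    have hsub : (Finset.univ.filter fun c => (cell x' c).1 = (cell x' c).2) ⊆
        (Finset.univ.filter fun c => (cell x c).1 = (cell x c).2) := by
      intro c hc
      simp only [Finset.mem_filter, Finset.mem_univ, true_and] at hc ⊢
      obtain ⟨h1, h2⟩ := h c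
      rw [← hc] at h2
      have : y (φ x) c = (cell x' c).1 := le_antisymm h2 h1
      simp only [cell] at this ⊢
      rw [this]; simp
    have heq := Finset.eq_of_subset_of_card_le hsub hrr.ge
    funext c
    obtain ⟨h1, h2⟩ := h c
    by_cases hc : (cell x' c).1 = (cell x' c).2
    · rw [← hc] at h2
      have h3 : y (φ x) c = (cell x' c).1 := le_antisymm h2 h1
      have : cell x c = ((cell x' c).1, (cell x' c).1) := by
        change (⌊y (φ x) c⌋, ⌈y (φ x) c⌉) = _
        rw [h3]; simp
      rw [this]; exact Prod.ext rfl hc.symm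
    · have hc' : (cell x c).1 ≠ (cell x c).2 := by
        intro hcc
        have : c ∈ (Finset.univ.filter fun c => (cell x c).1 = (cell x c).2) := by simpa using hcc
        rw [← heq] at this
        exact hc (by simpa using this)
      -- floor < y < ceil
      have ha : ∀ u : ℝ, ⌊u⌋ ≠ ⌈u⌉ → ⌈u⌉ = ⌊u⌋ + 1 := by
        intro u hu
        have h1 := Int.ceil_le_floor_add_one u
        have h2 := Int.floor_le_ceil u
        omega
      have h5 := ha _ hc
      have h6 := ha _ hc'
      have g1 : (cell x' c).1 ≤ (cell x c).1 := Int.le_floor.2 h1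
      have g2 : (cell x c).2 ≤ (cell x' c).2 := Int.ceil_le.2 h2
      change (cell x' c).2 = (cell x' c).1 + 1 at h5
      change (cell x c).2 = (cell x c).1 + 1 at h6
      exact Prod.ext (by omega) (by omega)
  have hsmall : ∀ x x', cell x = cell x' → dist (φ x') (φ x) < δ := by
    intro x x' hxx
    rw [dist_pi_lt_iff hδ]
    intro c
    have h1 := congrFun hxx c
    have hf : ⌊y (φ x) c⌋ = ⌊y (φ x') c⌋ := congrArg Prod.fst h1
    have := Int.abs_sub_lt_one_of_floor_eq_floor hf
    have e : φ x' c - φ x c = - (η * (y (φ x) c - y (φ x') c)) := by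
      simp only [y]; field_simp; ring
    rw [Real.dist_eq, e, abs_neg, abs_mul, abs_of_pos hη0]
    nlinarith
  have hbi : ∀ σ : Set.range cell, ∃ i, Z σ ⊆ W i := by
    rintro ⟨_, x, rfl⟩
    obtain ⟨i, hi⟩ := hb (φ x) ⟨x, rfl⟩
    refine ⟨i, ?_⟩
    rintro _ ⟨x', hx', rfl⟩
    exact hi (hsmall x x' (Eq.symm hx'))
  choose I hI using hbi
  have : Finite (Set.range cell) := hfin
  let V : Set.range cell → Set X := fun σ =>
    φ ⁻¹' (W (I σ) ∩ ⋂ τ : Set.range cell, {x | r τ = r σ → τ ≠ σ →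
      Metric.infDist x (Z σ) < Metric.infDist x (Z τ)})
  refine ⟨Set.range cell, V, hfin, ?_, ?_, ?_, ?_⟩
  · intro σ
    refine IsOpen.preimage hφ.continuous ((hW _).inter (isOpen_iInter_of_finite fun τ => ?_))
    by_cases h1 : r τ = r σ
    · by_cases h2 : τ ≠ σ
      · simp only [h1, h2, true_imp_iff, ne_eq, not_false_eq_true, forall_const]
        exact isOpen_lt (Metric.continuous_infDist_pt _) (Metric.continuous_infDist_pt _)
      · simp [h2]
    · simp [h1]
  · rw [Set.eq_univ_iff_forall]
    intro x
    refine Set.mem_iUnion.2 ⟨⟨cell x, x, rfl⟩, ?_, ?_⟩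
    · exact hI ⟨cell x, x, rfl⟩ ⟨x, rfl, rfl⟩
    · refine Set.mem_iInter.2 ?_
      rintro ⟨τ, hτ⟩ h1 h2
      have hz : φ x ∈ Z (cell x) := ⟨x, rfl, rfl⟩
      change Metric.infDist (φ x) (Z (cell x)) < _
      rw [Metric.infDist_zero_of_mem hz]
      have hne : (Z τ).Nonempty := by
        obtain ⟨x', rfl⟩ := hτ
        exact ⟨φ x', x', rfl, rfl⟩
      exact (Metric.infDist_pos_iff_notMem_closure hne).1
        (hsep x τ hτ h1 (fun h => h2 (Subtype.ext h)))
  · intro σ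
    refine ⟨I σ, ?_⟩
    rw [← hWU]
    exact Set.preimage_mono Set.inter_subset_left
  · intro x
    have hmaps : ∀ σ ∈ {σ | x ∈ V σ}, r (σ : ι → ℤ × ℤ) ∈ Set.Iic m := by
      rintro ⟨_, x', rfl⟩ _; exact hrm x'
    have hinj : Set.InjOn (fun σ : Set.range cell => r (σ : ι → ℤ × ℤ)) {σ | x ∈ V σ} := by
      intro σ hσ τ hτ hst
      by_contra hne
      have a1 := Set.mem_iInter.1 hσ.2 τ hst.symm (Ne.symm hne)
      have a2 := Set.mem_iInter.1 hτ.2 σ hst hne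
      exact lt_asymm a1 a2
    refine (Set.ncard_le_ncard_of_injOn _ hmaps hinj (Set.finite_Iic m)).trans ?_
    simp

lemma cube_embed {N : ℕ} (s : Finset (Fin N → ℝ)) (hs : s.Nonempty) (k : ℕ)
    (hk : Module.finrank ℝ (vectorSpan ℝ (s : Set (Fin N → ℝ))) = k) :
    ∃ c : (Fin k → unitInterval) → (Fin N → ℝ), Continuous c ∧ Function.Injective c ∧
      ∀ x, c x ∈ convexHull ℝ (s : Set (Fin N → ℝ)) := by
  obtain ⟨p, hp⟩ := hs
  obtain ⟨b, hb1, hb2, hb3⟩ := exists_linearIndependent ℝ ((fun q => q -ᵥ p) '' (s : Set (Fin N → ℝ)))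
  have hbfin : b.Finite := (s.finite_toSet.image _).subset hb1
  have : Fintype b := hbfin.fintype
  rw [vectorSpan_eq_span_vsub_set_right ℝ (show p ∈ (s : Set (Fin N → ℝ)) from hp), ← hb2,
    finrank_span_set_eq_card hb3, Set.toFinset_card] at hk
  let eqv : Fin k ≃ b := (Fintype.equivFinOfCardEq hk).symm
  let e : Fin k → Fin N → ℝ := fun i => (eqv i : Fin N → ℝ)
  have hli : LinearIndependent ℝ e := hb3.comp eqv eqv.injective
  have hes : ∀ i, p + e i ∈ s := by
    intro i
    obtain ⟨q, hq, hqe⟩ := hb1 (eqv i).2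
    have : p + e i = q := by
      simp only [e, ← hqe]; simp
    rw [this]; exact hq
  let w : (Fin k → unitInterval) → Fin k → ℝ := fun x i => (x i : ℝ) / (k + 1)
  refine ⟨fun x => p + ∑ i, w x i • e i, ?_, ?_, ?_⟩
  · simp only [w]; fun_prop
  · intro x x' hxx
    have h1 : ∑ i, w x i • e i = ∑ i, w x' i • e i := add_left_cancel hxx
    have h2 : ∑ i, (w x i - w x' i) • e i = 0 := by
      simp only [sub_smul, Finset.sum_sub_distrib, h1, sub_self]
    have h3 := Fintype.linearIndependent_iff.1 hli _ h2
    funext i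
    have h4 := h3 i
    simp only [w] at h4
    have hk0 : (k:ℝ) + 1 ≠ 0 := by positivity
    field_simp at h4
    exact Subtype.ext (by linarith)
  · intro x
    have hw0 : ∀ i, 0 ≤ w x i := fun i => div_nonneg (x i).2.1 (by positivity)
    have hw1 : ∑ i, w x i ≤ 1 := by
      have : ∀ i ∈ Finset.univ, w x i ≤ 1 / ((k:ℝ) + 1) := fun i _ =>
        div_le_div_of_nonneg_right (x i).2.2 (by positivity)
      refine (Finset.sum_le_sum this).trans ?_
      simp only [Finset.sum_const, Finset.card_univ, Fintype.card_fin, nsmul_eq_mul]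
      rw [mul_one_div, div_le_one (by positivity)]; linarith
    have := (convex_convexHull ℝ (s : Set (Fin N → ℝ))).sum_mem (t := Finset.univ)
      (w := (Fin.cons (1 - ∑ i, w x i) (w x) : Fin (k+1) → ℝ))
      (z := (Fin.cons p (fun i => p + e i) : Fin (k+1) → Fin N → ℝ))
      (by intro i _; refine Fin.cases ?_ (fun j => ?_) i
          · simpa using hw1
          · simpa using hw0 j)
      (by simp [Fin.sum_univ_succ])
      (by intro i _; refine Fin.cases ?_ (fun j => ?_) i
          · exact subset_convexHull _ _ hp
          · exact subset_convexHull _ _ (hes j))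
    have e2 : ∑ i : Fin (k+1), (Fin.cons (1 - ∑ i, w x i) (w x) : Fin (k+1) → ℝ) i •
        (Fin.cons p (fun i => p + e i) : Fin (k+1) → Fin N → ℝ) i = p + ∑ i, w x i • e i := by
      simp only [Fin.sum_univ_succ, Fin.cons_zero, Fin.cons_succ, smul_add, Finset.sum_add_distrib,
        ← Finset.sum_smul, sub_smul, one_smul]
      abel
    rw [e2] at this
    exact this

lemma le_topDim (X : Type) [TopologicalSpace X] (k : ℕ) (h : ∀ j, covDimLE X j → k ≤ j) :
    (k : ENNReal) ≤ topDim X := by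
  refine le_sInf ?_
  rintro _ ⟨j, rfl, hj⟩
  exact_mod_cast h j hj

lemma topDim_le (X : Type) [TopologicalSpace X] (k : ℕ) (h : covDimLE X k) :
    topDim X ≤ k := sInf_le ⟨k, rfl, h⟩

lemma eps_exists (P : Type) [MetricSpace P] (k : ℕ) (c : (Fin k → unitInterval) → P)
    (hc : Continuous c) (hinj : Function.Injective c) :
    ∃ ε₀ : ℝ, 0 < ε₀ ∧ ∀ i x y, x i = 0 → y i = 1 → ε₀ ≤ dist (c x) (c y) := by
  let K : Set ((Fin k → unitInterval) × (Fin k → unitInterval)) := ⋃ i, {z | z.1 i = 0 ∧ z.2 i = 1}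
  have hK : IsCompact K := by
    refine (isClosed_iUnion_of_finite fun i => ?_).isCompact
    exact (isClosed_eq (by fun_prop) continuous_const).inter (isClosed_eq (by fun_prop) continuous_const)
  rcases K.eq_empty_or_nonempty with hE | hne
  · refine ⟨1, one_pos, fun i x y hx hy => ?_⟩
    have : (x, y) ∈ K := Set.mem_iUnion.2 ⟨i, hx, hy⟩
    rw [hE] at this; exact this.elim
  · have hcont : ContinuousOn (fun z : (Fin k → unitInterval) × (Fin k → unitInterval) =>
        dist (c z.1) (c z.2)) K := by fun_prop
    obtain ⟨z, hz, hmin⟩ := hK.exists_isMinOn hne hcont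
    refine ⟨dist (c z.1) (c z.2), dist_pos.2 ?_, fun i x y hx hy =>
      hmin (show (x, y) ∈ K from Set.mem_iUnion.2 ⟨i, hx, hy⟩)⟩
    intro h
    obtain ⟨i, h0, h1⟩ := Set.mem_iUnion.1 hz
    rw [hinj h] at h0
    rw [h0] at h1
    exact zero_ne_one h1

/-- for a nonempty compact metric polyhedron `P` there is `ε₀ > 0`,
independent of `n`, with `dim_ε(P^n, d_n) = n · dim(P)` for all `0 < ε < ε₀` and `n ≥ 1`,
where `d_n` is the sup metric on `P^n`. -/
theorem stmt13 (P : Type) [MetricSpace P] [CompactSpace P] [Nonempty P]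
    (hP : IsPolyhedron P) :
    ∃ ε₀ : ℝ, 0 < ε₀ ∧ ∀ (n : ℕ) (hn : 1 ≤ n) (ε : ℝ), 0 < ε → ε < ε₀ →
      dimEps (Fin n → P)
        (fun x y => (Finset.univ : Finset (Fin n)).sup'
          (by have : Nonempty (Fin n) := Fin.pos_iff_nonempty.mp hn; exact Finset.univ_nonempty)
          (fun i => dist (x i) (y i))) ε
        = (n : ENNReal) * topDim P := by
  classical
  obtain ⟨N, S, ⟨h⟩⟩ := hP
  let S' : Finset (Finset (Fin N → ℝ)) := S.filter Finset.Nonempty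
  have hS' : ∀ x : P, ∃ s : S', (h x : Fin N → ℝ) ∈ convexHull ℝ ((s : Finset (Fin N → ℝ)) : Set (Fin N → ℝ)) := by
    intro x
    have := (h x).2
    simp only [Set.mem_iUnion] at this
    obtain ⟨s, hs, hx⟩ := this
    refine ⟨⟨s, Finset.mem_filter.2 ⟨hs, ?_⟩⟩, hx⟩
    have : (s : Set (Fin N → ℝ)).Nonempty := convexHull_nonempty_iff.1 ⟨_, hx⟩
    exact_mod_cast this
  have hS'ne : S'.Nonempty := by
    obtain ⟨x⟩ := ‹Nonempty P›
    obtain ⟨s, -⟩ := hS' x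
    exact ⟨s, s.2⟩
  let dm : Finset (Fin N → ℝ) → ℕ := fun s => Module.finrank ℝ (vectorSpan ℝ (s : Set (Fin N → ℝ)))
  obtain ⟨s₀, hs₀, hmax⟩ := Finset.exists_max_image S' dm hS'ne
  set k := dm s₀ with hk
  obtain ⟨c₀, hc₀, hc₀i, hc₀m⟩ := cube_embed s₀ (Finset.mem_filter.1 hs₀).2 k rfl
  let c : (Fin k → unitInterval) → P := fun x => h.symm ⟨c₀ x, by
    simp only [Set.mem_iUnion]
    exact ⟨s₀, (Finset.mem_filter.1 hs₀).1, hc₀m x⟩⟩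
  have hc : Continuous c := h.symm.continuous.comp (hc₀.subtype_mk _)
  have hci : Function.Injective c := by
    intro x y hxy
    have := h.symm.injective hxy
    exact hc₀i (Subtype.ext_iff.1 this)
  obtain ⟨ε₀, hε₀, hsep⟩ := eps_exists P k c hc hci
  -- base points and directions
  have hpt : ∀ s : S', ∃ q : Fin N → ℝ, q ∈ (s : Finset (Fin N → ℝ)) := fun s =>
    (Finset.mem_filter.1 s.2).2
  choose pt hpt using hpt
  let D : S' → Submodule ℝ (Fin N → ℝ) := fun s =>
    vectorSpan ℝ ((s : Finset (Fin N → ℝ)) : Set (Fin N → ℝ))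
  have hD : ∀ s, Module.finrank ℝ (D s) ≤ k := fun s => hmax s s.2
  have hmem : ∀ x : P, ∃ s : S', (h x : Fin N → ℝ) - pt s ∈ D s := by
    intro x
    obtain ⟨s, hs⟩ := hS' x
    refine ⟨s, ?_⟩
    have h1 := convexHull_subset_affineSpan _ hs
    have h2 : pt s ∈ affineSpan ℝ ((s : Finset (Fin N → ℝ)) : Set (Fin N → ℝ)) :=
      subset_affineSpan _ _ (hpt s)
    have := AffineSubspace.vsub_mem_direction h1 h2
    rw [direction_affineSpan] at this
    exact this
  have hPdim : topDim P = k := by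
    apply le_antisymm
    · apply topDim_le
      refine dim_upper k pt D hD P (fun x => (h x : Fin N → ℝ))
        (IsEmbedding.subtypeVal.comp h.isEmbedding) ?_
      intro x
      obtain ⟨s, hs⟩ := hmem x
      exact ⟨s, _, hs, by abel⟩
    · apply le_topDim
      intro j hj
      refine dim_lower k P c hc ?_ j hj
      intro i x y hx hy hxy
      have := hsep i x y hx hy
      rw [hxy, dist_self] at this
      linarith
  refine ⟨ε₀, hε₀, fun n hn ε hε hεε => ?_⟩
  rw [hPdim, ← Nat.cast_mul]
  apply le_antisymm
  · refine le_trans (b := topDim (Fin n → P))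
      (sInf_le ⟨Fin n → P, inferInstance, id, inferInstance, continuous_id, ?_, rfl⟩) ?_
    · intro x y hxy
      apply Finset.sup'_le
      intro i _
      rw [show x = y from hxy, dist_self]; exact hε.le
    · apply topDim_le
      let L : (t : Fin n → S') → ((a : Fin n) → D (t a)) →ₗ[ℝ] (Fin n × Fin N → ℝ) := fun t =>
        { toFun := fun e ab => (e ab.1 : Fin N → ℝ) ab.2
          map_add' := fun _ _ => rfl
          map_smul' := fun _ _ => rfl }
      let φ : (Fin n → P) → Fin n × Fin N → ℝ := fun x ab => (h (x ab.1) : Fin N → ℝ) ab.2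
      have hφc : Continuous φ := by
        refine continuous_pi fun ab => ?_
        exact (continuous_apply ab.2).comp (continuous_subtype_val.comp
          (h.continuous.comp (continuous_apply ab.1)))
      have hφi : Function.Injective φ := by
        intro x y hxy
        funext a
        apply h.injective
        apply Subtype.ext
        funext b
        exact congrFun hxy (a, b)
      refine dim_upper (n * k) (fun (t : Fin n → S') ab => pt (t ab.1) ab.2)
        (fun t => LinearMap.range (L t)) ?_ (Fin n → P) φ
        (hφc.isClosedEmbedding hφi).isEmbedding ?_
      · intro t
        refine (LinearMap.finrank_range_le _).trans ?_
        rw [Module.finrank_pi_fintype]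
        refine (Finset.sum_le_sum fun a _ => hD (t a)).trans ?_
        simp
      · intro x
        choose t ht using fun a => hmem (x a)
        refine ⟨t, _, ⟨fun a => ⟨_, ht a⟩, rfl⟩, ?_⟩
        funext ab
        simp [L, φ]
  · refine le_sInf ?_
    rintro _ ⟨Q, mQ, f, cQ, hf, hfe, rfl⟩
    apply le_topDim
    intro j hj
    refine dim_lower (n * k) Q (fun x => f (fun a => c (fun b => x (finProdFinEquiv (a, b))))) ?_ ?_ j hj
    · refine hf.comp (continuous_pi fun a => hc.comp (continuous_pi fun b => continuous_apply _))
    · intro i x y hx hy hxy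
      have h1 := hfe _ _ hxy
      obtain ⟨⟨a, b⟩, rfl⟩ := finProdFinEquiv.surjective i
      have h2 := hsep b (fun b => x (finProdFinEquiv (a, b))) (fun b => y (finProdFinEquiv (a, b))) hx hy
      have h3 := (Finset.sup'_le_iff _ _).1 h1 a (Finset.mem_univ a)
      simp only at h3
      linarith
end

section
/- Let G be a countably infinite amenable group, P a polyhedron with metric d, and X a closed G-invariant subset of P^G (with the shift action). Suppose there exist J ⊆ G, a point x₀ ∈ X, sets W_g ⊆ P for each g ∈ G with ∏_{g∈G} W_g ⊆ X and π_{G∖J}(x₀) ∈ π_{G∖J}(∏_{g∈G} W_g), and a constant c > 0 such that for every g ∈ J there is a continuous map f_g : P → W_g with d(x,y) ≤ c·d(f_g(x), f_g(y)) for all x,y ∈ P. Then mdim(X,G) ≥ δ(J)·dim(P), where δ(J) is the upper density of J and mdim is the mean topological dimension. -/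
open Set Filter Topology

/-- A Følner sequence in a group `G`: nonempty finite sets `F n` such that for every
finite `K ⊆ G`, the proportion of the `K`-boundary `B(F_n,K)` in `F_n` tends to `0`. -/
def IsFolner {G : Type} [Group G] (F : ℕ → Finset G) : Prop :=
  (∀ n, (F n).Nonempty) ∧ ∀ K : Finset G,
    Tendsto (fun n =>
        (Set.ncard {g : G | (∃ k ∈ K, k * g ∈ F n) ∧ ∃ k ∈ K, k * g ∉ F n} : ℝ)
          / (F n).card)
      atTop (nhds 0)

/-- The upper density of `J ⊆ G`: the supremum over Følner sequences of
`limsup_n |J ∩ F_n| / |F_n|`. -/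
noncomputable def upperDensity {G : Type} [Group G] (J : Set G) : ℝ :=
  sSup {r : ℝ | ∃ F : ℕ → Finset G, IsFolner F ∧
    Filter.atTop.limsup (fun n => ((J ∩ (F n : Set G)).ncard : ℝ) / (F n).card) = r}

/-- The shift map on `P^G`: `(g' · x)_g = x_{g g'}`. -/
def shift {G P : Type} [Group G] (g' : G) (x : G → P) : G → P :=
  fun g => x (g * g')

/-- `ρ` is a metric on `Y` compatible with the given topology. -/
def IsCompatMetric {Y : Type} [TopologicalSpace Y] (ρ : Y → Y → ℝ) : Prop :=
  (∀ x y, ρ x y = 0 ↔ x = y) ∧ (∀ x y, ρ x y = ρ y x) ∧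
  (∀ x y z, ρ x z ≤ ρ x y + ρ y z) ∧
  (∀ (x : Y) (S : Set Y), S ∈ nhds x ↔ ∃ ε > 0, {y | ρ x y < ε} ⊆ S)

/-- The mean topological dimension of a subshift `X ⊆ P^G`, computed from a compatible
metric `ρ` on `P^G` and a Følner sequence `F`:
`mdim = lim_{ε→0} lim_n dim_ε(X, d_{F_n})/|F_n|` with
`d_{F_n}(x,y) = max_{g ∈ F_n} ρ(gx, gy)`. -/
noncomputable def mdimWith {G P : Type} [Group G] [TopologicalSpace P]
    (X : Set (G → P)) (ρ : (G → P) → (G → P) → ℝ)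
    (F : ℕ → Finset G) (hF : ∀ n, (F n).Nonempty) : ENNReal :=
  ⨆ (ε : ℝ) (_ : 0 < ε), Filter.atTop.limsup fun n =>
    dimEps X (fun x y => (F n).sup' (hF n) fun g => ρ (shift g x.1) (shift g y.1)) ε
      / ((F n).card : ENNReal)

lemma aux_clamp_mem {ι : Type} [Fintype ι] (x : ι → ℝ) :
    (fun i => max 0 (min 1 (x i))) ∈ Icc (0 : ι → ℝ) 1 := by
  constructor
  · intro i; simp
  · intro i; simp

lemma aux_clamp_eq {ι : Type} [Fintype ι] (x : ι → ℝ) (hx : x ∈ Icc (0 : ι → ℝ) 1) :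
    (fun i => max 0 (min 1 (x i))) = x := by
  funext i
  have h0 : 0 ≤ x i := hx.1 i
  have h1 : x i ≤ 1 := hx.2 i
  simp [h0, h1]

lemma aux_clamp_lip {ι : Type} [Fintype ι] (x y : ι → ℝ) :
    dist (fun i => max 0 (min 1 (x i))) (fun i => max 0 (min 1 (y i))) ≤ dist x y := by
  rw [dist_pi_le_iff dist_nonneg]
  intro i
  refine le_trans ?_ (dist_le_pi_dist x y i)
  rw [Real.dist_eq, Real.dist_eq]
  have e1 := abs_max_sub_max_le_abs (min 1 (x i)) (min 1 (y i)) 0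
  have e2 := abs_min_sub_min_le_max 1 (x i) 1 (y i)
  rw [max_comm 0, max_comm 0]
  refine e1.trans (e2.trans ?_)
  simp

lemma aux_small_image {ι : Type} [Fintype ι] (h : (ι → ℝ) → (ι → ℝ)) (L : NNReal)
    (hL : LipschitzOnWith L h (Icc 0 1))
    (h0 : ∀ x ∈ Icc (0 : ι → ℝ) 1, ∀ i, x i = 0 → h x i = 0)
    (h1 : ∀ x ∈ Icc (0 : ι → ℝ) 1, ∀ i, x i = 1 → h x i = 0)
    (t : ℝ) (ht0 : 0 < t) (ht : t * L < 1) :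
    InjOn (fun x => x + t • h x) (Icc 0 1) ∧
    (fun x => x + t • h x) '' (Icc 0 1) = Icc 0 1 := by
  classical
  refine ⟨?_, ?_⟩
  · intro x hx y hy hxy
    have e1 : x - y = - (t • (h x - h y)) := by
      have : x + t • h x = y + t • h y := hxy
      rw [smul_sub]
      have := sub_eq_zero.mpr this
      rw [← sub_eq_zero, ← this]; abel
    have e2 : dist x y ≤ t * L * dist x y := by
      have := hL.dist_le_mul x hx y hy
      calc dist x y = t * dist (h x) (h y) := by
            rw [dist_eq_norm, e1, norm_neg, norm_smul, dist_eq_norm, Real.norm_of_nonneg ht0.le]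
        _ ≤ t * (L * dist x y) := by gcongr
        _ = _ := by ring
    have e3 : dist x y ≤ 0 := by nlinarith [dist_nonneg (x := x) (y := y)]
    exact dist_le_zero.mp e3
  · apply Subset.antisymm
    · rintro _ ⟨x, hx, rfl⟩
      have b0 : ∀ i, |h x i| ≤ L * x i := by
        intro i
        have hx' : Function.update x i 0 ∈ Icc (0 : ι → ℝ) 1 := by
          constructor <;> intro j <;> by_cases hj : j = i
          · subst hj; simp
          · simpa [hj] using hx.1 j
          · subst hj; simp
          · simpa [hj] using hx.2 j
        have := hL.dist_le_mul x hx _ hx'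
        have d1 : dist x (Function.update x i 0) ≤ x i := by
          rw [dist_pi_le_iff (hx.1 i)]
          intro j
          by_cases hj : j = i
          · subst hj; simp [abs_of_nonneg (show 0 ≤ x j from hx.1 j)]
          · simpa [hj] using hx.1 i
        have d2 := dist_le_pi_dist (h x) (h (Function.update x i 0)) i
        rw [h0 _ hx' i (by simp), Real.dist_eq, sub_zero] at d2
        calc _ ≤ _ := d2
          _ ≤ _ := this
          _ ≤ _ := by gcongr
      have b1 : ∀ i, |h x i| ≤ L * (1 - x i) := by
        intro i
        have hxi : 0 ≤ 1 - x i := sub_nonneg.mpr (hx.2 i)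
        have hx' : Function.update x i 1 ∈ Icc (0 : ι → ℝ) 1 := by
          constructor <;> intro j <;> by_cases hj : j = i
          · subst hj; simp
          · simpa [hj] using hx.1 j
          · subst hj; simp
          · simpa [hj] using hx.2 j
        have := hL.dist_le_mul x hx _ hx'
        have d1 : dist x (Function.update x i 1) ≤ 1 - x i := by
          rw [dist_pi_le_iff hxi]
          intro j
          by_cases hj : j = i
          · subst hj; simp [Real.dist_eq, abs_sub_comm (x j) 1, abs_of_nonneg hxi]
          · simpa [hj] using hxi
        have d2 := dist_le_pi_dist (h x) (h (Function.update x i 1)) i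
        rw [h1 _ hx' i (by simp), Real.dist_eq, sub_zero] at d2
        calc _ ≤ _ := d2
          _ ≤ _ := this
          _ ≤ _ := by gcongr
      constructor
      · intro i
        have := b0 i
        have hxi : 0 ≤ x i := hx.1 i
        have := neg_abs_le (h x i)
        simp only [Pi.zero_apply, Pi.add_apply, Pi.smul_apply, smul_eq_mul]
        nlinarith
      · intro i
        have := b1 i
        have hxi : x i ≤ 1 := hx.2 i
        have := le_abs_self (h x i)
        simp only [Pi.one_apply, Pi.add_apply, Pi.smul_apply, smul_eq_mul]
        nlinarith
    · intro y hy
      let T : (ι → ℝ) → (ι → ℝ) := fun x => y - t • h (fun i => max 0 (min 1 (x i)))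
      have hT : ContractingWith (⟨t, ht0.le⟩ * L) T := by
        refine ⟨?_, ?_⟩
        · exact_mod_cast ht
        · apply LipschitzWith.of_dist_le_mul
          intro a b
          have := hL.dist_le_mul _ (aux_clamp_mem a) _ (aux_clamp_mem b)
          calc dist (T a) (T b) = t * dist (h (fun i => max 0 (min 1 (a i)))) (h (fun i => max 0 (min 1 (b i)))) := by
                simp only [T]
                rw [dist_sub_left, dist_smul₀, Real.norm_of_nonneg ht0.le]
            _ ≤ t * (L * dist a b) := by
                gcongr
                refine this.trans ?_
                gcongr
                exact aux_clamp_lip a b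
            _ = _ := by change _ = t * L * _; ring
      obtain ⟨x, hx⟩ : ∃ x, T x = x := ⟨_, hT.fixedPoint_isFixedPt⟩
      have hxm : x ∈ Icc (0 : ι → ℝ) 1 := by
        constructor
        · intro i
          by_contra hlt
          simp only [Pi.zero_apply, not_le] at hlt
          have := congrFun hx i
          simp only [T, Pi.sub_apply, Pi.smul_apply] at this
          rw [h0 _ (aux_clamp_mem x) i (by simp [hlt.le])] at this
          have hyi : 0 ≤ y i := hy.1 i
          simp at this
          linarith
        · intro i
          by_contra hlt
          simp only [Pi.one_apply, not_le] at hlt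
          have := congrFun hx i
          simp only [T, Pi.sub_apply, Pi.smul_apply] at this
          rw [h1 _ (aux_clamp_mem x) i (by simp [hlt.le])] at this
          have hyi : y i ≤ 1 := hy.2 i
          simp at this
          linarith
      refine ⟨x, hxm, ?_⟩
      simp only [T] at hx
      rw [aux_clamp_eq x hxm] at hx
      simp only
      nth_rewrite 1 [← hx]
      simp

lemma aux_small_int {ι : Type} [Fintype ι] (h : (ι → ℝ) → (ι → ℝ)) (hC : ContDiff ℝ 1 h)
    (h0 : ∀ x ∈ Icc (0 : ι → ℝ) 1, ∀ i, x i = 0 → h x i = 0)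
    (h1 : ∀ x ∈ Icc (0 : ι → ℝ) 1, ∀ i, x i = 1 → h x i = 0) :
    ∃ τ : ℝ, 0 < τ ∧ ∀ t : ℝ, 0 < t → t < τ →
      ∫ x in Icc (0 : ι → ℝ) 1, (ContinuousLinearMap.id ℝ (ι → ℝ) + t • fderiv ℝ h x).det = 1 := by
  obtain ⟨L, hL⟩ := hC.contDiffOn.exists_lipschitzOnWith one_ne_zero
    (convex_Icc (0 : ι → ℝ) 1) isCompact_Icc
  have hcd : Continuous fun z : ℝ × (ι → ℝ) =>
      (ContinuousLinearMap.id ℝ (ι → ℝ) + z.1 • fderiv ℝ h z.2).det := by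
    have := hC.continuous_fderiv one_ne_zero
    refine ContinuousLinearMap.continuous_det.comp ?_
    fun_prop
  have hpos : ∀ᶠ t in 𝓝 (0 : ℝ), ∀ x ∈ Icc (0 : ι → ℝ) 1,
      0 < (ContinuousLinearMap.id ℝ (ι → ℝ) + t • fderiv ℝ h x).det := by
    apply isCompact_Icc.eventually_forall_of_forall_eventually
    intro y _
    apply hcd.continuousAt.eventually (lt_mem_nhds ?_)
    simp [ContinuousLinearMap.det]
  have hsm : ∀ᶠ t in 𝓝 (0 : ℝ), t * (L : ℝ) < 1 := by
    have : Continuous fun t : ℝ => t * L := by fun_prop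
    apply this.continuousAt.eventually (gt_mem_nhds ?_)
    simp
  obtain ⟨τ, hτ, hball⟩ := Metric.eventually_nhds_iff.mp (hpos.and hsm)
  refine ⟨τ, hτ, fun t ht0 htτ => ?_⟩
  obtain ⟨hp, hs⟩ := hball (y := t) (by simpa [abs_of_pos ht0] using htτ)
  obtain ⟨hinj, himg⟩ := aux_small_image h L hL h0 h1 t ht0 hs
  have key := MeasureTheory.lintegral_abs_det_fderiv_eq_addHaar_image
    (MeasureTheory.volume : MeasureTheory.Measure (ι → ℝ)) (s := Icc 0 1)
    (f := fun x => x + t • h x)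
    (f' := fun x => ContinuousLinearMap.id ℝ (ι → ℝ) + t • fderiv ℝ h x)
    measurableSet_Icc (fun x _ => by
      have := (hC.differentiable one_ne_zero x).hasFDerivAt
      exact ((hasFDerivAt_id x).add (this.const_smul t)).hasFDerivWithinAt) hinj
  rw [himg] at key
  have hv : MeasureTheory.volume (Icc (0 : ι → ℝ) 1) = 1 := by
    rw [Real.volume_Icc_pi]; simp
  rw [hv] at key
  rw [MeasureTheory.integral_eq_lintegral_of_nonneg_ae]
  · rw [← ENNReal.toReal_one, ← key]
    congr 1
    apply MeasureTheory.setLIntegral_congr_fun measurableSet_Icc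
    intro x hx
    simp only
    rw [abs_of_pos (hp x hx)]
  · filter_upwards [MeasureTheory.ae_restrict_mem measurableSet_Icc] with x hx
    exact (hp x hx).le
  · have : Continuous fun x : ι → ℝ =>
      (ContinuousLinearMap.id ℝ (ι → ℝ) + t • fderiv ℝ h x).det :=
      hcd.comp (by fun_prop : Continuous fun x : ι → ℝ => (t, x))
    exact this.aestronglyMeasurable

lemma aux_det_poly {ι : Type} [Fintype ι] (A : (ι → ℝ) →L[ℝ] (ι → ℝ)) :
    ∃ p : Polynomial ℝ, p.natDegree ≤ Fintype.card ι ∧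
      ∀ t, p.eval t = (ContinuousLinearMap.id ℝ (ι → ℝ) + t • A).det := by
  classical
  let M := LinearMap.toMatrix' (A : (ι → ℝ) →ₗ[ℝ] (ι → ℝ))
  refine ⟨_, Polynomial.natDegree_det_X_add_C_le M 1, fun t => ?_⟩
  rw [← Polynomial.coe_evalRingHom, RingHom.map_det]
  rw [ContinuousLinearMap.det, ← LinearMap.det_toMatrix']
  congr 1
  have : ((ContinuousLinearMap.id ℝ (ι → ℝ) + t • A : (ι → ℝ) →L[ℝ] (ι → ℝ)) : (ι → ℝ) →ₗ[ℝ] (ι → ℝ))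
    = LinearMap.id + t • (A : (ι → ℝ) →ₗ[ℝ] (ι → ℝ)) := by
    ext; simp
  have e : LinearMap.toMatrix' (LinearMap.id + t • (A : (ι → ℝ) →ₗ[ℝ] (ι → ℝ))) = 1 + t • M := by
    rw [map_add, map_smul, LinearMap.toMatrix'_id]
  rw [this, e]
  ext i j
  by_cases hij : i = j <;> simp [M, hij, add_comm] <;> ring

lemma aux_det_ne {ι : Type} [Fintype ι] (g : (ι → ℝ) → (ι → ℝ)) (hC : ContDiff ℝ 1 g)
    (h0 : ∀ x ∈ Icc (0 : ι → ℝ) 1, ∀ i, x i = 0 → g x i = 0)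
    (h1 : ∀ x ∈ Icc (0 : ι → ℝ) 1, ∀ i, x i = 1 → g x i = 1) :
    ∃ x ∈ Icc (0 : ι → ℝ) 1, (fderiv ℝ g x).det ≠ 0 := by
  classical
  by_contra hcon
  push Not at hcon
  let h : (ι → ℝ) → (ι → ℝ) := fun x => g x - x
  have hhC : ContDiff ℝ 1 h := hC.sub contDiff_id
  obtain ⟨τ, hτ, hint⟩ := aux_small_int h hhC
    (fun x hx i hi => by simp [h, h0 x hx i hi, hi])
    (fun x hx i hi => by simp [h, h1 x hx i hi, hi])
  set m := Fintype.card ι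
  let v : ℕ → ℝ := fun j => τ / (j + 2)
  have hv0 : ∀ j, 0 < v j := fun j => by positivity
  have hvτ : ∀ j, v j < τ := fun j => by
    have : (0 : ℝ) ≤ j := Nat.cast_nonneg j
    simp only [v]
    rw [div_lt_iff₀ (by positivity)]
    nlinarith
  have hvi : InjOn v (Finset.range (m + 1) : Set ℕ) := by
    intro a _ b _ hab
    simp only [v] at hab
    have ha : (a : ℝ) + 2 ≠ 0 := by positivity
    have hb : (b : ℝ) + 2 ≠ 0 := by positivity
    rw [div_eq_div_iff ha hb] at hab
    have := mul_left_cancel₀ hτ.ne' hab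
    have : (a : ℝ) = b := by linarith
    exact_mod_cast this
  let w : ℕ → ℝ := fun j => (Lagrange.basis (Finset.range (m + 1)) v j).eval 1
  have hw : ∑ j ∈ Finset.range (m + 1), w j = 1 := by
    have := Lagrange.sum_basis hvi (by simp)
    have := congrArg (Polynomial.eval 1) this
    simpa [Polynomial.eval_finsetSum] using this
  let D : ℝ → (ι → ℝ) → ℝ := fun t x => (ContinuousLinearMap.id ℝ (ι → ℝ) + t • fderiv ℝ h x).det
  have hinterp : ∀ x, D 1 x = ∑ j ∈ Finset.range (m + 1), w j * D (v j) x := by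
    intro x
    obtain ⟨p, hp, hpe⟩ := aux_det_poly (fderiv ℝ h x)
    have := Lagrange.eq_interpolate (f := p) hvi (by
      rw [Finset.card_range]
      exact lt_of_le_of_lt Polynomial.degree_le_natDegree (by exact_mod_cast Nat.lt_succ_of_le hp))
    have := congrArg (Polynomial.eval 1) this
    rw [Lagrange.interpolate_apply, Polynomial.eval_finsetSum] at this
    simp only [Polynomial.eval_mul, Polynomial.eval_C, hpe] at this
    simp only [D, w]
    rw [this]
    exact Finset.sum_congr rfl fun j _ => mul_comm _ _
  have hz : ∀ x ∈ Icc (0 : ι → ℝ) 1, D 1 x = 0 := by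
    intro x hx
    have : ContinuousLinearMap.id ℝ (ι → ℝ) + (1 : ℝ) • fderiv ℝ h x = fderiv ℝ g x := by
      have : fderiv ℝ h x = fderiv ℝ g x - ContinuousLinearMap.id ℝ (ι → ℝ) := by
        simp only [h]
        rw [fderiv_fun_sub (hC.differentiable one_ne_zero x) differentiableAt_fun_id]
        simp
      rw [this]; simp
    simp only [D]
    rw [this]
    exact hcon x hx
  have hDc : ∀ t, Continuous (D t) := by
    intro t
    have := hhC.continuous_fderiv one_ne_zero
    refine ContinuousLinearMap.continuous_det.comp ?_
    fun_prop
  have e1 : ∫ x in Icc (0 : ι → ℝ) 1, D 1 x = 0 := by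
    rw [MeasureTheory.setIntegral_congr_fun measurableSet_Icc (g := fun _ => (0 : ℝ)) hz]
    simp
  have e2 : ∫ x in Icc (0 : ι → ℝ) 1, D 1 x = ∑ j ∈ Finset.range (m + 1), w j * 1 := by
    simp_rw [hinterp]
    rw [MeasureTheory.integral_finsetSum]
    · refine Finset.sum_congr rfl fun j _ => ?_
      rw [MeasureTheory.integral_const_mul]
      rw [hint (v j) (hv0 j) (hvτ j)]
    · intro j _
      apply Continuous.integrableOn_Icc
      exact continuous_const.mul (hDc _)
  rw [e1] at e2
  simp [hw] at e2
lemma aux_lebesgue {ι : Type} [Fintype ι] {Q : Type} [TopologicalSpace Q] [T2Space Q]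
    (ψ : (ι → ℝ) → Q) (hψ : Continuous ψ)
    (hsep : ∀ a ∈ Icc (0 : ι → ℝ) 1, ∀ b ∈ Icc (0 : ι → ℝ) 1, ∀ i,
      a i = 0 → b i = 1 → ψ a ≠ ψ b)
    (n : ℕ) (hn : covDimLE Q n) : Fintype.card ι ≤ n := by
  classical
  by_contra hlt
  push Not at hlt
  let A : ι → Set Q := fun i => ψ '' (Icc (0 : ι → ℝ) 1 ∩ {a | a i = 0})
  let B : ι → Set Q := fun i => ψ '' (Icc (0 : ι → ℝ) 1 ∩ {a | a i = 1})
  have hA : ∀ i, IsClosed (A i) := fun i =>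
    ((isCompact_Icc.inter_right (isClosed_eq (continuous_apply i) continuous_const)).image hψ).isClosed
  have hB : ∀ i, IsClosed (B i) := fun i =>
    ((isCompact_Icc.inter_right (isClosed_eq (continuous_apply i) continuous_const)).image hψ).isClosed
  let U : (ι → Bool) → Set Q := fun s => ⋂ i, if s i then (A i)ᶜ else (B i)ᶜ
  have hUo : ∀ s, IsOpen (U s) := by
    intro s
    apply isOpen_iInter_of_finite
    intro i
    split_ifs
    · exact (hA i).isOpen_compl
    · exact (hB i).isOpen_compl
  have hUc : (⋃ s, U s) = univ := by
    rw [eq_univ_iff_forall]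
    intro q
    rw [mem_iUnion]
    refine ⟨fun i => decide (q ∉ A i), ?_⟩
    simp only [U, mem_iInter]
    intro i
    by_cases hq : q ∈ A i
    · simp only [hq, not_true_eq_false, decide_false, Bool.false_eq_true, if_false, mem_compl_iff]
      rintro ⟨b, ⟨hb, hbi⟩, rfl⟩
      obtain ⟨a, ⟨ha, hai⟩, hab⟩ := hq
      exact hsep a ha b hb i hai hbi hab
    · simp [hq]
  obtain ⟨κ, V, hκ, hVo, hVc, hVU, hord⟩ := hn (ι → Bool) U inferInstance hUo hUc
  choose s hs using hVU
  have := Fintype.ofFinite κ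
  obtain ⟨f, hf⟩ := SmoothPartitionOfUnity.exists_isSubordinate (modelWithCornersSelf ℝ (ι → ℝ))
    (s := (univ : Set (ι → ℝ))) isClosed_univ (fun j => ψ ⁻¹' V j) (fun j => (hVo j).preimage hψ)
    (by rw [← preimage_iUnion, hVc]; simp)
  let φ : κ → (ι → ℝ) → ℝ := fun j => f j
  have hφC : ∀ j, ContDiff ℝ 1 (φ j) := fun j => ((f j).contMDiff.contDiff).of_le (by exact_mod_cast le_top)
  have hφ1 : ∀ x, ∑ j, φ j x = 1 := by
    intro x
    have := f.sum_eq_one (mem_univ x)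
    rwa [finsum_eq_sum_of_fintype] at this
  have hφs : ∀ j x, x ∈ tsupport (φ j) → ψ x ∈ V j := fun j x hx => hf j hx
  let v : κ → ι → ℝ := fun j i => if s j i then 1 else 0
  let g : (ι → ℝ) → (ι → ℝ) := fun x => ∑ j, φ j x • v j
  have hgC : ContDiff ℝ 1 g := ContDiff.sum fun j _ => (hφC j).smul contDiff_const
  have g0 : ∀ x ∈ Icc (0 : ι → ℝ) 1, ∀ i, x i = 0 → g x i = 0 := by
    intro x hx i hi
    simp only [g, Finset.sum_apply, Pi.smul_apply, smul_eq_mul]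
    apply Finset.sum_eq_zero
    intro j _
    by_cases hj : φ j x = 0
    · simp [hj]
    · have h1 := hs j (hφs j x (subset_tsupport _ hj))
      simp only [U, mem_iInter] at h1
      have h1 := h1 i
      have : s j i = false := by
        by_contra hne
        simp only [Bool.not_eq_false] at hne
        rw [hne] at h1
        simp only [if_true] at h1
        exact h1 ⟨x, ⟨hx, hi⟩, rfl⟩
      simp [v, this]
  have g1 : ∀ x ∈ Icc (0 : ι → ℝ) 1, ∀ i, x i = 1 → g x i = 1 := by
    intro x hx i hi
    rw [← hφ1 x]
    simp only [g, Finset.sum_apply, Pi.smul_apply, smul_eq_mul]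
    apply Finset.sum_congr rfl
    intro j _
    by_cases hj : φ j x = 0
    · simp [hj]
    · have h1 := hs j (hφs j x (subset_tsupport _ hj))
      simp only [U, mem_iInter] at h1
      have h1 := h1 i
      have : s j i = true := by
        by_contra hne
        simp only [Bool.not_eq_true] at hne
        rw [hne] at h1
        simp only [Bool.false_eq_true, if_false] at h1
        exact h1 ⟨x, ⟨hx, hi⟩, rfl⟩
      simp [v, this]
  obtain ⟨x, _, hdet⟩ := aux_det_ne g hgC g0 g1
  apply hdet
  -- the derivative has small rank
  let S : Finset κ := Finset.univ.filter fun j => x ∈ tsupport (φ j)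
  have hScard : S.card ≤ n + 1 := by
    refine le_trans ?_ (hord (ψ x))
    rw [← Set.ncard_coe_finset]
    apply Set.ncard_le_ncard _ (Set.toFinite _)
    intro j hj
    simp only [S, Finset.coe_filter, Finset.mem_univ, true_and, mem_ofPred_eq] at hj
    exact hφs j x hj
  have hSne : S.Nonempty := by
    by_contra hS
    rw [Finset.not_nonempty_iff_eq_empty] at hS
    have : ∑ j, φ j x = 0 := Finset.sum_eq_zero fun j _ => by
      by_contra hj
      have : j ∈ S := by simp [S, subset_tsupport _ hj]
      simp [hS] at this
    rw [hφ1] at this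
    exact one_ne_zero this
  obtain ⟨j0, hj0⟩ := hSne
  have hd : ∀ j, j ∉ S → fderiv ℝ (φ j) x = 0 := by
    intro j hj
    have : x ∉ tsupport (φ j) := by simpa [S] using hj
    by_contra hne
    exact this (support_fderiv_subset ℝ (f := φ j) hne)
  have hdsum : ∑ j, fderiv ℝ (φ j) x = 0 := by
    have : (fun y => ∑ j, φ j y) = fun _ => (1 : ℝ) := funext hφ1
    have h2 : fderiv ℝ (fun y => ∑ j, φ j y) x = 0 := by rw [this]; simp
    rwa [fderiv_fun_sum fun j _ => (hφC j).differentiable one_ne_zero x] at h2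
  have hgd : ∀ y, fderiv ℝ g x y = ∑ j ∈ S.erase j0, (fderiv ℝ (φ j) x y) • (v j - v j0) := by
    intro y
    have e1 : fderiv ℝ g x y = ∑ j, (fderiv ℝ (φ j) x y) • v j := by
      simp only [g]
      rw [fderiv_fun_sum fun j _ => 
        ((hφC j).differentiable one_ne_zero x).smul_const (v j)]
      simp only [sum_apply]
      refine Finset.sum_congr rfl fun j _ => ?_
      rw [fderiv_smul_const ((hφC j).differentiable one_ne_zero x)]
      simp
    have e2 : ∑ j, (fderiv ℝ (φ j) x y) • v j0 = 0 := by
      rw [← Finset.sum_smul]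
      have := congrArg (fun A => A y) hdsum
      simp only [sum_apply] at this
      rw [this]; simp
    have e3 : fderiv ℝ g x y = ∑ j, (fderiv ℝ (φ j) x y) • (v j - v j0) := by
      simp_rw [smul_sub]
      rw [Finset.sum_sub_distrib, e2, e1, sub_zero]
    rw [e3]
    symm
    apply Finset.sum_subset (Finset.subset_univ _)
    intro j _ hj
    by_cases hjj : j = j0
    · subst hjj; simp
    · have : j ∉ S := fun h => hj (Finset.mem_erase.mpr ⟨hjj, h⟩)
      rw [hd j this]; simp
  by_contra hne
  have hsurj : LinearMap.range (fderiv ℝ g x : (ι → ℝ) →ₗ[ℝ] (ι → ℝ)) = ⊤ := by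
    rw [← LinearMap.ker_eq_bot_iff_range_eq_top]
    by_contra h
    exact hne (LinearMap.det_eq_zero_iff_ker_ne_bot.mpr h)
  have hle : LinearMap.range (fderiv ℝ g x : (ι → ℝ) →ₗ[ℝ] (ι → ℝ)) ≤
      Submodule.span ℝ (((S.erase j0).image fun j => v j - v j0 : Finset (ι → ℝ)) : Set (ι → ℝ)) := by
    rintro _ ⟨y, rfl⟩
    change fderiv ℝ g x y ∈ _
    rw [hgd]
    refine Submodule.sum_mem _ fun j hj => Submodule.smul_mem _ _ (Submodule.subset_span ?_)
    exact Finset.mem_coe.mpr (Finset.mem_image_of_mem _ hj)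
  have h1 := finrank_span_finset_le_card (R := ℝ) ((S.erase j0).image fun j => v j - v j0)
  rw [hsurj, top_le_iff] at hle
  rw [Set.finrank, hle, finrank_top, Module.finrank_fintype_fun_eq_card] at h1
  have h2 := Finset.card_image_le (s := S.erase j0) (f := fun j => v j - v j0)
  rw [Finset.card_erase_of_mem hj0] at h2
  omega

lemma aux_dround_cont : Continuous fun u : ℝ => |u - round u| := by
  have : LipschitzWith 1 fun u : ℝ => |u - round u| := by
    apply LipschitzWith.of_le_add
    intro u v
    calc |u - round u| ≤ |u - round v| := round_le u (round v)
      _ = |(v - round v) + (u - v)| := by congr 1; ring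
      _ ≤ |v - round v| + |u - v| := abs_add_le _ _
      _ = _ := by rw [Real.dist_eq]
  exact this.continuous

lemma aux_covDim_homeo {X Y : Type} [TopologicalSpace X] [TopologicalSpace Y] (e : X ≃ₜ Y) (n : ℕ)
    (h : covDimLE Y n) : covDimLE X n := by
  intro ι U hι hU hc
  obtain ⟨κ, V, hκ, hVo, hVc, hVU, hord⟩ := h ι (fun i => e.symm ⁻¹' U i) hι
    (fun i => (hU i).preimage e.symm.continuous)
    (by rw [← preimage_iUnion, hc]; simp)
  refine ⟨κ, fun j => e ⁻¹' V j, hκ, fun j => (hVo j).preimage e.continuous,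
    by rw [← preimage_iUnion, hVc]; simp, fun j => ?_, fun x => hord (e x)⟩
  obtain ⟨i, hi⟩ := hVU j
  refine ⟨i, fun x hx => ?_⟩
  have := hi hx
  simpa using this

/-- Selecting a good threshold. -/
lemma aux_select {N : ℕ} (d : Fin N → ℝ) (k : ℕ) (θ : ℝ) (hθ : 0 < θ)
    (hk : (Finset.univ.filter fun i => d i ≤ θ * (k + 1)).card ≤ k) :
    ∃ j ≤ k, (Finset.univ.filter fun i => d i < θ * (j + 1)).card = j ∧
      ∀ i, d i ≠ θ * (j + 1) := by
  classical
  let Nn : ℕ → ℕ := fun j => (Finset.univ.filter fun i => d i ≤ θ * (j + 1)).card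
  have hex : ∃ j, Nn j ≤ j := ⟨k, hk⟩
  let j := Nat.find hex
  have hj : Nn j ≤ j := Nat.find_spec hex
  have hjk : j ≤ k := Nat.find_min' hex hk
  have hsub : (Finset.univ.filter fun i => d i < θ * (j + 1)) ⊆
      (Finset.univ.filter fun i => d i ≤ θ * (j + 1)) :=
    Finset.monotone_filter_right _ fun i _ h => le_of_lt h
  have hge : j ≤ (Finset.univ.filter fun i => d i < θ * (j + 1)).card := by
    by_cases h0 : j = 0
    · omega
    · obtain ⟨l, hl⟩ := Nat.exists_eq_succ_of_ne_zero h0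
      have hlt : ¬ Nn l ≤ l := Nat.find_min hex (by change l < j; omega)
      have : (Finset.univ.filter fun i => d i ≤ θ * (l + 1)) ⊆
        (Finset.univ.filter fun i => d i < θ * (j + 1)) := by
        apply Finset.monotone_filter_right
        intro i _ h
        refine lt_of_le_of_lt h ?_
        rw [hl]; push_cast; nlinarith
      have := Finset.card_le_card this
      change ¬ (Finset.univ.filter fun i => d i ≤ θ * (l + 1)).card ≤ l at hlt
      omega
  have hle := Finset.card_le_card hsub
  have heq : (Finset.univ.filter fun i => d i < θ * (j + 1)) =
      (Finset.univ.filter fun i => d i ≤ θ * (j + 1)) :=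
    Finset.eq_of_subset_of_card_le hsub (hj.trans hge)
  refine ⟨j, hjk, le_antisymm (hle.trans hj) hge, fun i hi => ?_⟩
  have : i ∈ (Finset.univ.filter fun i => d i ≤ θ * (j + 1)) := by simp [hi]
  rw [← heq] at this
  simp [hi] at this

/-- The faces-neighbourhoods of the grid. -/
lemma aux_covDim_grid {N : ℕ} (K : Set (Fin N → ℝ)) (hK : IsCompact K) (hKne : K.Nonempty) (k : ℕ)
    (hgrid : ∀ r > 0, ∃ t : Fin N → ℝ, ∀ x ∈ K, ∀ T : Finset (Fin N),
      (∀ i ∈ T, ∃ z : ℤ, x i = t i + r * z) → T.card ≤ k) :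
    covDimLE K k := by
  classical
  intro ι U hι hU hc
  have : CompactSpace K := isCompact_iff_compactSpace.mp hK
  obtain ⟨l, hl, hleb⟩ := lebesgue_number_lemma_of_metric (isCompact_univ (X := K)) hU hc.ge
  let r : ℝ := l / 4
  have hr : 0 < r := by positivity
  obtain ⟨t, ht⟩ := hgrid r hr
  let u : (Fin N → ℝ) → Fin N → ℝ := fun x i => (x i - t i) / r
  have huc : ∀ i, Continuous fun x => u x i := fun i => by
    simp only [u]; fun_prop
  let d : (Fin N → ℝ) → Fin N → ℝ := fun x i => |u x i - round (u x i)|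
  have hdc : ∀ i, Continuous fun x => d x i := fun i => aux_dround_cont.comp (huc i)
  have hev : ∀ᶠ η in 𝓝 (0 : ℝ), ∀ x ∈ K, (Finset.univ.filter fun i => d x i ≤ η).card ≤ k := by
    apply hK.eventually_forall_of_forall_eventually
    intro y hy
    have h1 : ∀ i, d y i ≠ 0 → ∀ᶠ z in 𝓝 ((0 : ℝ), y), z.1 < d z.2 i := by
      intro i hi
      have hp : 0 < d y i := lt_of_le_of_ne (abs_nonneg _) (Ne.symm hi)
      exact (isOpen_lt continuous_fst ((hdc i).comp continuous_snd)).mem_nhds hp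
    have h2 : ∀ᶠ z in 𝓝 ((0 : ℝ), y), ∀ i, d y i ≠ 0 → z.1 < d z.2 i := by
      rw [eventually_all]
      intro i
      by_cases hi : d y i = 0
      · simp [hi]
      · filter_upwards [h1 i hi] with z hz _ using hz
    filter_upwards [h2] with z hz
    apply ht y hy
    intro i hi
    simp only [Finset.mem_filter, Finset.mem_univ, true_and] at hi
    have : d y i = 0 := by
      by_contra hne
      exact absurd (hz i hne) (not_lt.mpr hi)
    refine ⟨round (u y i), ?_⟩
    have := sub_eq_zero.mp (abs_eq_zero.mp this)
    rw [← this]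
    simp only [u]
    field_simp
    ring
  obtain ⟨η, hη, hηb⟩ := Metric.eventually_nhds_iff.mp hev
  obtain ⟨θ, hθ, hθη, hθ2⟩ : ∃ θ : ℝ, 0 < θ ∧ θ * (k + 1) < η ∧ θ * (k + 1) < 1 / 2 := by
    refine ⟨min η (1/2) / (2 * (k + 1)), by positivity, ?_, ?_⟩
    · have h1 : min η (1/2) / (2 * ((k : ℝ) + 1)) * (k + 1) = min η (1/2) / 2 := by field_simp
      rw [h1]
      have := min_le_left η (1/2 : ℝ)
      linarith
    · have h1 : min η (1/2) / (2 * ((k : ℝ) + 1)) * (k + 1) = min η (1/2) / 2 := by field_simp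
      rw [h1]
      have := min_le_right η (1/2 : ℝ)
      linarith
  have hcard : ∀ x ∈ K, (Finset.univ.filter fun i => d x i ≤ θ * (k + 1)).card ≤ k := by
    apply hηb
    rw [Real.dist_eq, sub_zero, abs_of_pos (by positivity)]
    exact hθη
  -- boundedness
  obtain ⟨B, hB⟩ : ∃ B : ℤ, ∀ x ∈ K, ∀ i, |u x i| ≤ B := by
    have : ∀ i, ∃ C : ℝ, ∀ x ∈ K, |u x i| ≤ C := by
      intro i
      obtain ⟨C, hC⟩ := hK.exists_bound_of_continuousOn (huc i).continuousOn
      exact ⟨C, fun x hx => by simpa using hC x hx⟩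
    choose C hC using this
    obtain ⟨M, hM⟩ := (Set.finite_range C).bddAbove
    refine ⟨⌈M⌉, fun x hx i => (hC i x hx).trans ((hM ⟨i, rfl⟩).trans (Int.le_ceil M))⟩
  let δ : Finset (Fin N) → ℝ := fun S => θ * (S.card + 1)
  let κ := Finset (Fin N) × (Fin N → Finset.Icc (-(B + 1)) (B + 1))
  let V : κ → Set K := fun p => {x | p.1.card ≤ k ∧
    (∀ i ∈ p.1, |u x i - (p.2 i : ℤ)| < δ p.1) ∧
    ∀ i ∉ p.1, ((p.2 i : ℤ) : ℝ) + δ p.1 < u x i ∧ u x i < (p.2 i : ℤ) + 1 - δ p.1}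
  have hδlt : ∀ S : Finset (Fin N), S.card ≤ k → δ S < 1 / 2 := by
    intro S hS
    refine lt_of_le_of_lt ?_ hθ2
    have : (S.card : ℝ) ≤ k := by exact_mod_cast hS
    simp only [δ]
    gcongr
  have hδpos : ∀ S, 0 < δ S := fun S => by simp only [δ]; positivity
  have huc' : ∀ i, Continuous fun x : K => u x i := fun i => (huc i).comp continuous_subtype_val
  refine ⟨κ, V, inferInstance, ?_, ?_, ?_, ?_⟩
  · rintro ⟨S, m⟩
    have e1 : IsOpen {x : K | ∀ i ∈ S, |u x i - (m i : ℤ)| < δ S} := by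
      simp only [ofPred_forall]
      refine isOpen_iInter_of_finite fun i => isOpen_iInter_of_finite fun _ => ?_
      exact isOpen_lt ((huc' i).sub continuous_const).abs continuous_const
    have e2 : IsOpen {x : K | ∀ i ∉ S, ((m i : ℤ) : ℝ) + δ S < u x i ∧ u x i < (m i : ℤ) + 1 - δ S} := by
      simp only [ofPred_forall]
      refine isOpen_iInter_of_finite fun i => isOpen_iInter_of_finite fun _ => ?_
      exact (isOpen_lt continuous_const (huc' i)).inter (isOpen_lt (huc' i) continuous_const)
    exact isOpen_const.and (e1.and e2)
  · rw [eq_univ_iff_forall]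
    rintro ⟨x, hx⟩
    obtain ⟨j, hjk, hj1, hj2⟩ := aux_select (d x) k θ hθ (hcard x hx)
    set S := Finset.univ.filter fun i => d x i < θ * (j + 1) with hS
    have hδS : δ S = θ * (j + 1) := by simp only [δ]; rw [hj1]
    have hmem : ∀ i, (if i ∈ S then round (u x i) else ⌊u x i⌋) ∈ Finset.Icc (-(B + 1)) (B + 1) := by
      intro i
      have hb := abs_le.mp (hB x hx i)
      rw [Finset.mem_Icc]
      split_ifs
      · have h1 := abs_le.mp (abs_sub_round (u x i))
        constructor
        · have : ((-(B + 1) : ℤ) : ℝ) ≤ round (u x i) := by push_cast; linarith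
          exact_mod_cast this
        · have : ((round (u x i) : ℤ) : ℝ) ≤ ((B + 1 : ℤ) : ℝ) := by push_cast; linarith
          exact_mod_cast this
      · have h1 := Int.floor_le (u x i)
        have h2 := Int.lt_floor_add_one (u x i)
        constructor
        · have : ((-(B + 1) : ℤ) : ℝ) ≤ ⌊u x i⌋ := by push_cast; linarith
          exact_mod_cast this
        · have : ((⌊u x i⌋ : ℤ) : ℝ) ≤ ((B + 1 : ℤ) : ℝ) := by push_cast; linarith
          exact_mod_cast this
    rw [mem_iUnion]
    refine ⟨(S, fun i => ⟨_, hmem i⟩), ?_, ?_, ?_⟩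
    · change S.card ≤ k
      omega
    · intro i hi
      change i ∈ S at hi
      change |u x i - ((if i ∈ S then round (u x i) else ⌊u x i⌋ : ℤ) : ℝ)| < δ S
      rw [if_pos hi, hδS]
      simpa [hS] using hi
    · intro i hi
      change i ∉ S at hi
      change ((if i ∈ S then round (u x i) else ⌊u x i⌋ : ℤ) : ℝ) + δ S < u x i ∧
        u x i < ((if i ∈ S then round (u x i) else ⌊u x i⌋ : ℤ) : ℝ) + 1 - δ S
      rw [if_neg hi, hδS]
      have h1 : θ * (j + 1) ≤ d x i := by simpa [hS] using hi
      have h2 := lt_of_le_of_ne h1 (Ne.symm (hj2 i))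
      simp only [d] at h2
      rw [abs_sub_round_eq_min] at h2
      have h3 := lt_min_iff.mp h2
      have h4 := Int.floor_add_fract (u x i)
      constructor <;> linarith [h3.1, h3.2]
  · rintro ⟨S, m⟩
    by_cases hne : (V (S, m)).Nonempty
    · obtain ⟨x, hx⟩ := hne
      obtain ⟨i, hi⟩ := hleb x (mem_univ _)
      refine ⟨i, fun y hy => hi ?_⟩
      rw [Metric.mem_ball]
      refine lt_of_le_of_lt ?_ (show 2 * r < l by simp only [r]; linarith)
      rw [Subtype.dist_eq, dist_pi_le_iff (by positivity)]
      intro a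
      have hd := hδlt S hx.1
      have hd0 := hδpos S
      have key : |u y a - u x a| ≤ 2 := by
        by_cases ha : a ∈ S
        · have h1 := abs_lt.mp (hx.2.1 a ha)
          have h2 := abs_lt.mp (hy.2.1 a ha)
          change _ < _ ∧ _ < δ S at h1
          change _ < _ ∧ _ < δ S at h2
          rw [abs_le]
          constructor <;> linarith [h1.1, h1.2, h2.1, h2.2]
        · have h1 := hx.2.2 a ha
          have h2 := hy.2.2 a ha
          change _ + δ S < _ ∧ _ < _ - δ S at h1
          change _ + δ S < _ ∧ _ < _ - δ S at h2
          rw [abs_le]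
          constructor <;> linarith [h1.1, h1.2, h2.1, h2.2]
      have e : u y.1 a - u x.1 a = (y.1 a - x.1 a) / r := by simp only [u]; ring
      rw [e, abs_div, abs_of_pos hr, div_le_iff₀ hr] at key
      rw [Real.dist_eq]
      exact key
    · obtain ⟨i⟩ : Nonempty ι := by
        by_contra hemp
        rw [not_nonempty_iff] at hemp
        have hKe : IsEmpty K := by
          rw [← univ_eq_empty_iff, ← hc]; simp
        exact hKe.elim ⟨_, hKne.some_mem⟩
      exact ⟨i, by rw [not_nonempty_iff_eq_empty.mp hne]; simp⟩
  · intro x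
    have hinj : InjOn (fun p : κ => p.1.card) {p | x ∈ V p} := by
      rintro ⟨S, m⟩ hp ⟨S', m'⟩ hp' hcc
      change S.card = S'.card at hcc
      have hδδ : δ S' = δ S := by simp only [δ]; rw [hcc]
      obtain ⟨hk1, hn1, hf1⟩ := hp
      obtain ⟨hk2, hn2, hf2⟩ := hp'
      simp only at hk1 hn1 hf1 hk2 hn2 hf2
      rw [hδδ] at hn2 hf2
      have hd := hδlt S hk1
      have hd0 := hδpos S
      have hsub : ∀ A A' : Finset (Fin N), ∀ M M' : Fin N → Finset.Icc (-(B + 1)) (B + 1),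
          (∀ i ∈ A, |u x i - (M i : ℤ)| < δ S) →
          (∀ i ∉ A', ((M' i : ℤ) : ℝ) + δ S < u x i ∧ u x i < (M' i : ℤ) + 1 - δ S) → A ⊆ A' := by
        intro A A' M M' h1 h2 i hi
        by_contra hi'
        have a1 := abs_lt.mp (h1 i hi)
        have a2 := h2 i hi'
        have b1 : ((M' i : ℤ) : ℝ) < (M i : ℤ) := by linarith [a1.2, a2.1]
        have b2 : (((M i : ℤ)) : ℝ) < ((M' i : ℤ) : ℝ) + 1 := by linarith [a1.1, a2.2]
        have b1' : (M' i : ℤ) < (M i : ℤ) := by exact_mod_cast b1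
        have b2' : (M i : ℤ) < (M' i : ℤ) + 1 := by exact_mod_cast b2
        omega
      have hSS : S = S' := Finset.Subset.antisymm (hsub S S' m m' hn1 hf2) (hsub S' S m' m hn2 hf1)
      subst hSS
      congr 1
      funext i
      apply Subtype.ext
      by_cases hi : i ∈ S
      · have a1 := abs_lt.mp (hn1 i hi)
        have a2 := abs_lt.mp (hn2 i hi)
        have b1 : ((m i : ℤ) : ℝ) < (m' i : ℤ) + 1 := by linarith [a1.1, a2.2]
        have b2 : ((m' i : ℤ) : ℝ) < (m i : ℤ) + 1 := by linarith [a1.2, a2.1, a1.1, a2.2]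
        have b1' : (m i : ℤ) < (m' i : ℤ) + 1 := by exact_mod_cast b1
        have b2' : (m' i : ℤ) < (m i : ℤ) + 1 := by exact_mod_cast b2
        omega
      · have a1 := hf1 i hi
        have a2 := hf2 i hi
        have b1 : ((m i : ℤ) : ℝ) < (m' i : ℤ) + 1 := by linarith [a1.1, a2.2]
        have b2 : ((m' i : ℤ) : ℝ) < (m i : ℤ) + 1 := by linarith [a1.2, a2.1, a1.1, a2.2]
        have b1' : (m i : ℤ) < (m' i : ℤ) + 1 := by exact_mod_cast b1
        have b2' : (m' i : ℤ) < (m i : ℤ) + 1 := by exact_mod_cast b2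
        omega
    have hmap : ∀ p ∈ {p | x ∈ V p}, (fun p : κ => p.1.card) p ∈ (Finset.range (k + 1) : Set ℕ) := by
      rintro p hp
      simpa [Nat.lt_succ_iff] using hp.1
    have := Set.ncard_le_ncard_of_injOn _ hmap hinj (Finset.finite_toSet _)
    rwa [Set.ncard_coe_finset, Finset.card_range] at this

/-- A linear relation between the coordinates in `T` on a low-dimensional polytope. -/
lemma aux_relation {N : ℕ} (s : Finset (Fin N → ℝ)) (T : Finset (Fin N))
    (hT : Module.finrank ℝ (vectorSpan ℝ (s : Set (Fin N → ℝ))) < T.card) :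
    ∃ (a : Fin N → ℝ) (b : ℝ), (∃ i ∈ T, a i ≠ 0) ∧
      ∀ x ∈ convexHull ℝ (s : Set (Fin N → ℝ)), ∑ i ∈ T, a i * x i = b := by
  classical
  let W := vectorSpan ℝ (s : Set (Fin N → ℝ))
  let Ψ : (T → ℝ) →ₗ[ℝ] Module.Dual ℝ W :=
    { toFun := fun a =>
        { toFun := fun v => ∑ i : T, a i * (v : Fin N → ℝ) i
          map_add' := fun v w => by
            simp [mul_add, Finset.sum_add_distrib]
          map_smul' := fun c v => by
            simp only [Submodule.coe_smul, Pi.smul_apply, smul_eq_mul, RingHom.id_apply, Finset.mul_sum]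
            exact Finset.sum_congr rfl fun i _ => by ring }
      map_add' := fun a a' => by
        ext v
        simp [add_mul, Finset.sum_add_distrib]
      map_smul' := fun c a => by
        ext v
        simp [Finset.mul_sum, mul_assoc] }
  have hker : LinearMap.ker Ψ ≠ ⊥ := by
    apply LinearMap.ker_ne_bot_of_finrank_lt
    rw [Subspace.dual_finrank_eq, Module.finrank_fintype_fun_eq_card, Fintype.card_coe]
    exact hT
  obtain ⟨a, ha, hane⟩ := Submodule.exists_mem_ne_zero_of_ne_bot hker
  let a' : Fin N → ℝ := fun i => if h : i ∈ T then a ⟨i, h⟩ else 0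
  have hsum : ∀ y : Fin N → ℝ, ∑ i ∈ T, a' i * y i = ∑ i : T, a i * y i := by
    intro y
    rw [← Finset.sum_coe_sort T]
    refine Finset.sum_congr rfl fun i _ => ?_
    simp [a']
  have hne : ∃ i ∈ T, a' i ≠ 0 := by
    obtain ⟨i, hi⟩ := Function.ne_iff.mp hane
    exact ⟨i, i.2, by simpa [a'] using hi⟩
  by_cases hs : (convexHull ℝ (s : Set (Fin N → ℝ))).Nonempty
  · obtain ⟨x₁, hx₁⟩ := hs
    refine ⟨a', ∑ i ∈ T, a' i * x₁ i, hne, fun x hx => ?_⟩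
    have hmem : x -ᵥ x₁ ∈ W := by
      have h1 := convexHull_subset_affineSpan (s : Set (Fin N → ℝ)) hx
      have h2 := convexHull_subset_affineSpan (s : Set (Fin N → ℝ)) hx₁
      have := AffineSubspace.vsub_mem_direction h1 h2
      rwa [direction_affineSpan] at this
    have h3 : Ψ a ⟨_, hmem⟩ = 0 := by
      rw [LinearMap.mem_ker.mp ha]; simp
    have h4 : ∑ i : T, a i * (x -ᵥ x₁) i = 0 := h3
    rw [← hsum] at h4
    simp only [vsub_eq_sub, Pi.sub_apply, mul_sub, Finset.sum_sub_distrib] at h4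
    linarith
  · refine ⟨a', 0, hne, fun x hx => absurd ⟨x, hx⟩ hs⟩

lemma aux_generic {N : ℕ} (S : Finset (Finset (Fin N → ℝ))) (k : ℕ)
    (hS : ∀ s ∈ S, Module.finrank ℝ (vectorSpan ℝ (s : Set (Fin N → ℝ))) ≤ k) (r : ℝ) :
    ∃ t : Fin N → ℝ, ∀ x ∈ (⋃ s ∈ S, convexHull ℝ (s : Set (Fin N → ℝ)) : Set (Fin N → ℝ)),
      ∀ T : Finset (Fin N), (∀ i ∈ T, ∃ z : ℤ, x i = t i + r * z) → T.card ≤ k := by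
  classical
  have hrel : ∀ p : {p : Finset (Fin N → ℝ) × Finset (Fin N) // p.1 ∈ S ∧ k < p.2.card},
      ∃ (a : Fin N → ℝ) (b : ℝ), (∃ i ∈ p.1.2, a i ≠ 0) ∧
      ∀ x ∈ convexHull ℝ (p.1.1 : Set (Fin N → ℝ)), ∑ i ∈ p.1.2, a i * x i = b :=
    fun p => aux_relation p.1.1 p.1.2 ((hS _ p.2.1).trans_lt p.2.2)
  choose a b hane hab using hrel
  let I := {p : Finset (Fin N → ℝ) × Finset (Fin N) // p.1 ∈ S ∧ k < p.2.card}
  have hIfin : Countable I := by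
    have : Set.Finite {p : Finset (Fin N → ℝ) × Finset (Fin N) | p.1 ∈ S ∧ k < p.2.card} := by
      apply Set.Finite.subset ((Finset.finite_toSet S).prod (Set.finite_univ (α := Finset (Fin N))))
      rintro p ⟨h1, _⟩
      exact ⟨h1, mem_univ _⟩
    exact this.countable.to_subtype
  let poly : I × (Fin N → ℤ) → Polynomial ℝ := fun q =>
    ∑ i ∈ q.1.1.2, Polynomial.C (a q.1 i) * Polynomial.X ^ ((i : ℕ) + 1) +
      Polynomial.C ((∑ i ∈ q.1.1.2, a q.1 i * (r * q.2 i)) - b q.1)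
  have hpoly : ∀ q, poly q ≠ 0 := by
    intro q h0
    obtain ⟨i, hi, hai⟩ := hane q.1
    apply hai
    have := congrArg (fun p => p.coeff ((i : ℕ) + 1)) h0
    simp only [poly, Polynomial.coeff_add, Polynomial.finsetSum_coeff, Polynomial.coeff_C_mul,
      Polynomial.coeff_X_pow, Polynomial.coeff_C_succ, Polynomial.coeff_zero, add_zero,
      add_left_inj] at this
    rw [Finset.sum_eq_single i] at this
    · simpa using this
    · intro j _ hj
      have : (i : ℕ) ≠ j := fun h => hj (Fin.ext h.symm)
      simp [this]
    · intro h; exact absurd hi h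
  have hcount : (⋃ q, {τ : ℝ | (poly q).IsRoot τ}).Countable :=
    Set.countable_iUnion fun q => (Polynomial.finite_setOfPred_isRoot (hpoly q)).countable
  obtain ⟨τ, hτ⟩ : ∃ τ : ℝ, τ ∉ ⋃ q, {τ : ℝ | (poly q).IsRoot τ} := by
    by_contra hcon
    push Not at hcon
    have : (univ : Set ℝ).Countable := hcount.mono fun x _ => hcon x
    exact Cardinal.not_countable_real this
  refine ⟨fun i => τ ^ ((i : ℕ) + 1), fun x hx T hT => ?_⟩
  by_contra hlt
  push Not at hlt
  simp only [mem_iUnion, exists_prop] at hx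
  obtain ⟨s, hs, hxs⟩ := hx
  let p : I := ⟨(s, T), hs, hlt⟩
  have hz : ∃ z : Fin N → ℤ, ∀ i ∈ T, x i = τ ^ ((i : ℕ) + 1) + r * z i := by
    choose z hz using hT
    exact ⟨fun i => if h : i ∈ T then z i h else 0, fun i hi => by simp [hi, hz i hi]⟩
  obtain ⟨z, hz⟩ := hz
  apply hτ
  rw [mem_iUnion]
  refine ⟨(p, z), ?_⟩
  change Polynomial.eval τ (poly (p, z)) = 0
  have h1 := hab p x hxs
  have h2 : ∑ i ∈ T, a p i * x i = ∑ i ∈ T, (a p i * τ ^ ((i : ℕ) + 1) + a p i * (r * z i)) :=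
    Finset.sum_congr rfl fun i hi => by rw [hz i hi]; ring
  rw [Finset.sum_add_distrib] at h2
  simp only [poly, Polynomial.eval_add, Polynomial.eval_finsetSum, Polynomial.eval_mul,
    Polynomial.eval_C, Polynomial.eval_pow, Polynomial.eval_X]
  change ∑ i ∈ T, a p i * x i = b p at h1
  change ∑ i ∈ T, a p i * τ ^ ((i : ℕ) + 1) + (∑ i ∈ T, a p i * (r * z i) - b p) = 0
  linarith

lemma aux_cube {N : ℕ} (s : Finset (Fin N → ℝ)) (hs : s.Nonempty) (k : ℕ)
    (hk : Module.finrank ℝ (vectorSpan ℝ (s : Set (Fin N → ℝ))) = k) :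
    ∃ E : (Fin k → ℝ) → (Fin N → ℝ), Continuous E ∧ Function.Injective E ∧
      ∀ a ∈ Icc (0 : Fin k → ℝ) 1, E a ∈ convexHull ℝ (s : Set (Fin N → ℝ)) := by
  classical
  subst hk
  obtain ⟨p, hp⟩ := hs
  rw [vectorSpan_eq_span_vsub_set_right ℝ (Finset.mem_coe.mpr hp)]
  obtain ⟨f, hfm, -, hfl⟩ := Submodule.exists_fun_fin_finrank_span_eq ℝ
    ((fun x => x -ᵥ p) '' (s : Set (Fin N → ℝ)))
  generalize Module.finrank ℝ (Submodule.span ℝ ((fun x => x -ᵥ p) '' (s : Set (Fin N → ℝ)))) = k at f hfm hfl ⊢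
  have hkk : (0 : ℝ) < (k : ℝ) + 1 := by positivity
  refine ⟨fun a => p + ((k : ℝ) + 1)⁻¹ • ∑ i, a i • f i, by fun_prop, ?_, ?_⟩
  · intro a b hab
    simp only [add_right_inj] at hab
    have h1 := smul_right_injective (Fin N → ℝ) (inv_ne_zero hkk.ne') hab
    have h2 : ∑ i, (a i - b i) • f i = 0 := by
      simp_rw [sub_smul]
      rw [Finset.sum_sub_distrib]
      exact sub_eq_zero.mpr h1
    have h3 := Fintype.linearIndependent_iff.mp hfl _ h2
    funext i
    exact sub_eq_zero.mp (h3 i)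
  · intro a ha
    have hconv := convex_convexHull ℝ (s : Set (Fin N → ℝ))
    have hpm : p ∈ convexHull ℝ (s : Set (Fin N → ℝ)) := subset_convexHull ℝ _ hp
    have hseg : ∀ i, p + a i • f i ∈ convexHull ℝ (s : Set (Fin N → ℝ)) := by
      intro i
      obtain ⟨q, hq, hqf⟩ := hfm i
      have hqm : q ∈ convexHull ℝ (s : Set (Fin N → ℝ)) := subset_convexHull ℝ _ hq
      have : p + a i • f i = (1 - a i) • p + a i • q := by
        simp only [vsub_eq_sub] at hqf
        rw [← hqf, smul_sub, sub_smul, one_smul]; abel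
      rw [this]
      exact hconv hpm hqm (sub_nonneg.mpr (ha.2 i)) (ha.1 i) (by ring)
    have hsum := hconv.sum_mem (t := Finset.univ) (w := fun _ : Option (Fin k) => ((k : ℝ) + 1)⁻¹)
      (z := fun o => o.elim p fun i => p + a i • f i) (fun _ _ => by positivity)
      (by simp; field_simp) (by rintro (_ | i) _; exacts [hpm, hseg i])
    convert hsum using 1
    rw [Fintype.sum_option]
    simp only [Option.elim, smul_add, Finset.sum_add_distrib, Finset.smul_sum]
    rw [← add_assoc]
    congr 1
    simp only [Finset.sum_const, Finset.card_univ, Fintype.card_fin]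
    rw [← Nat.cast_smul_eq_nsmul ℝ, smul_smul, ← add_smul]
    have : ((k : ℝ) + 1)⁻¹ + k * ((k : ℝ) + 1)⁻¹ = 1 := by field_simp; ring
    rw [this, one_smul]

lemma aux_poly (P : Type) [TopologicalSpace P] [Nonempty P] (hP : IsPolyhedron P) :
    ∃ k : ℕ, covDimLE P k ∧ ∃ e : (Fin k → ℝ) → P, Continuous e ∧ InjOn e (Icc 0 1) := by
  classical
  obtain ⟨N, S, ⟨h⟩⟩ := hP
  set K : Set (Fin N → ℝ) := ⋃ s ∈ S, convexHull ℝ (s : Set (Fin N → ℝ)) with hKdef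
  have hKc : IsCompact K := S.finite_toSet.isCompact_biUnion fun s _ =>
    s.finite_toSet.isCompact_convexHull (𝕜 := ℝ)
  obtain ⟨p⟩ := ‹Nonempty P›
  have hKne : K.Nonempty := ⟨h p, (h p).2⟩
  let S' := S.filter fun s => s.Nonempty
  have hS'ne : S'.Nonempty := by
    obtain ⟨x, hx⟩ := hKne
    simp only [hKdef, mem_iUnion, exists_prop] at hx
    obtain ⟨s, hs, hxs⟩ := hx
    refine ⟨s, Finset.mem_filter.mpr ⟨hs, ?_⟩⟩
    have := convexHull_nonempty_iff.mp ⟨x, hxs⟩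
    simpa using this
  obtain ⟨s₀, hs₀, hmax⟩ := S'.exists_max_image
    (fun s => Module.finrank ℝ (vectorSpan ℝ (s : Set (Fin N → ℝ)))) hS'ne
  set k := Module.finrank ℝ (vectorSpan ℝ (s₀ : Set (Fin N → ℝ))) with hk
  refine ⟨k, ?_, ?_⟩
  · apply aux_covDim_homeo h
    apply aux_covDim_grid K hKc hKne
    intro r _
    apply aux_generic
    intro s hs
    by_cases hne : s.Nonempty
    · exact hmax s (Finset.mem_filter.mpr ⟨hs, hne⟩)
    · have h0 : vectorSpan ℝ (s : Set (Fin N → ℝ)) = ⊥ := by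
        rw [Finset.not_nonempty_iff_eq_empty.mp hne, Finset.coe_empty, vectorSpan_empty]
      rw [h0, finrank_bot]
      exact Nat.zero_le _
  · obtain ⟨E, hEc, hEi, hEm⟩ := aux_cube s₀ (Finset.mem_filter.mp hs₀).2 k hk.symm
    have hmem : ∀ a : Fin k → ℝ, E (fun i => max 0 (min 1 (a i))) ∈ K := by
      intro a
      exact mem_biUnion (show s₀ ∈ (S : Set _) from (Finset.mem_filter.mp hs₀).1) (hEm _ (aux_clamp_mem a))
    refine ⟨fun a => h.symm ⟨_, hmem a⟩, ?_, ?_⟩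
    · refine h.symm.continuous.comp (Continuous.subtype_mk (hEc.comp ?_) _)
      fun_prop
    · intro a ha b hb hab
      have h1 := congrArg Subtype.val (h.symm.injective hab)
      have h2 := hEi h1
      rwa [aux_clamp_eq a ha, aux_clamp_eq b hb] at h2

lemma aux_folner_bound {G : Type} [Group G] (F : ℕ → Finset G) (hF : IsFolner F) (J : Set G)
    (E : Finset G) (hE : E.Nonempty) (m : ℕ)
    (hm : ∀ g : G, (J ∩ {h | ∃ e ∈ E, h = e * g}).ncard ≤ m) :
    Filter.atTop.limsup (fun n => ((J ∩ (F n : Set G)).ncard : ℝ) / (F n).card) ≤ m / E.card := by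
  classical
  let b : G → ℕ → ℝ := fun e n =>
    (Set.ncard {g : G | (∃ k ∈ ({1, e⁻¹} : Finset G), k * g ∈ F n) ∧
      ∃ k ∈ ({1, e⁻¹} : Finset G), k * g ∉ F n} : ℝ) / (F n).card
  have hb : ∀ e, Tendsto (b e) atTop (𝓝 0) := fun e => hF.2 _
  have hEc : (0 : ℝ) < E.card := by exact_mod_cast hE.card_pos
  let R : ℕ → ℝ := fun n => (m + ∑ e ∈ E, b e n) / E.card
  have hR : Tendsto R atTop (𝓝 (m / E.card)) := by
    have h1 : Tendsto (fun n => ∑ e ∈ E, b e n) atTop (𝓝 (∑ e ∈ E, 0)) :=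
      tendsto_finsetSum _ fun e _ => hb e
    have h2 := (tendsto_const_nhds (x := (m : ℝ))).add h1
    have h3 := h2.div_const (E.card : ℝ)
    simpa using h3
  have hle : ∀ n, ((J ∩ (F n : Set G)).ncard : ℝ) / (F n).card ≤ R n := by
    intro n
    have hFc : (0 : ℝ) < (F n).card := by exact_mod_cast (hF.1 n).card_pos
    -- finset versions
    let A : Finset G := (F n).filter (· ∈ J)
    have hA : (J ∩ (F n : Set G)).ncard = A.card := by
      rw [← Set.ncard_coe_finset]
      congr 1
      ext g; simp [A, and_comm]
    have hBfin : ∀ e, Set.Finite {g : G | (∃ k ∈ ({1, e⁻¹} : Finset G), k * g ∈ F n) ∧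
      ∃ k ∈ ({1, e⁻¹} : Finset G), k * g ∉ F n} := by
      intro e
      apply Set.Finite.subset ((F n).finite_toSet.union (((F n).finite_toSet).image fun h => e * h))
      rintro g ⟨⟨k, hk, hkg⟩, _⟩
      simp only [Finset.mem_insert, Finset.mem_singleton] at hk
      rcases hk with rfl | rfl
      · left; simpa using hkg
      · right; exact ⟨_, hkg, by simp⟩
    have h1 : ∀ e ∈ E, (A.card : ℝ) ≤ ((F n).filter fun g => e * g ∈ J).card + b e n * (F n).card := by
      intro e _
      have hbe : b e n * (F n).card = ((hBfin e).toFinset.card : ℝ) := by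
        simp only [b]
        rw [div_mul_cancel₀ _ hFc.ne', Set.ncard_eq_toFinset_card _ (hBfin e)]
      rw [hbe]
      have hsub : A ⊆ ((F n).filter fun g => e * g ∈ J).image (fun g => e * g) ∪ (hBfin e).toFinset := by
        intro h hh
        simp only [A, Finset.mem_filter] at hh
        rw [Finset.mem_union]
        by_cases hc : e⁻¹ * h ∈ F n
        · left
          rw [Finset.mem_image]
          exact ⟨e⁻¹ * h, by simp [hc, hh.2], by simp⟩
        · right
          simp only [Set.Finite.mem_toFinset]
          exact ⟨⟨1, by simp, by simpa using hh.1⟩, ⟨e⁻¹, by simp, hc⟩⟩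
      have := (Finset.card_le_card hsub).trans ((Finset.card_union_le _ _).trans
        (Nat.add_le_add_right Finset.card_image_le _))
      exact_mod_cast this
    have h2 : ∑ e ∈ E, ((F n).filter fun g => e * g ∈ J).card ≤ (F n).card * m := by
      have : ∑ e ∈ E, ((F n).filter fun g => e * g ∈ J).card
          = ∑ g ∈ F n, (E.filter fun e => e * g ∈ J).card := by
        simp only [Finset.card_filter]
        exact Finset.sum_comm
      rw [this, ← smul_eq_mul]
      apply Finset.sum_le_card_nsmul
      intro g _
      refine le_trans ?_ (hm g)
      rw [← Finset.card_image_of_injective _ (mul_left_injective g), ← Set.ncard_coe_finset]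
      apply Set.ncard_le_ncard
      · intro h hh
        simp only [Finset.coe_image, Finset.coe_filter, mem_image, mem_ofPred_eq] at hh
        obtain ⟨e, ⟨he, heJ⟩, rfl⟩ := hh
        exact ⟨heJ, e, he, rfl⟩
      · apply Set.Finite.subset (E.finite_toSet.image fun e => e * g)
        rintro h ⟨_, e, he, rfl⟩
        exact ⟨e, he, rfl⟩
    have h3 : (E.card : ℝ) * A.card ≤ (F n).card * m + (∑ e ∈ E, b e n) * (F n).card := by
      have := Finset.sum_le_sum h1
      rw [Finset.sum_const, nsmul_eq_mul, Finset.sum_add_distrib, ← Finset.sum_mul] at this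
      have h2' : (∑ e ∈ E, (((F n).filter fun g => e * g ∈ J).card : ℝ)) ≤ (F n).card * m := by
        exact_mod_cast h2
      linarith
    rw [hA]
    simp only [R]
    rw [div_le_div_iff₀ hFc hEc]
    linarith
  have := limsup_le_limsup (f := atTop) (Eventually.of_forall hle)
    (isCoboundedUnder_le_of_le _ (x := 0) fun n => by positivity) hR.isBoundedUnder_le
  exact this.trans hR.limsup_eq.le

lemma aux_density {G : Type} [Group G] (hAmen : ∃ F : ℕ → Finset G, IsFolner F) (J : Set G)
    (E : Finset G) (hE : E.Nonempty) :
    ∃ g : G, upperDensity J * E.card ≤ (J ∩ {h | ∃ e ∈ E, h = e * g}).ncard := by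
  classical
  let c : G → ℕ := fun g => (J ∩ {h | ∃ e ∈ E, h = e * g}).ncard
  have hc : ∀ g, c g ≤ E.card := by
    intro g
    refine le_trans (Set.ncard_le_ncard (t := ((E.image fun e => e * g : Finset G) : Set G)) ?_ (Finset.finite_toSet _)) ?_
    · rintro h ⟨_, e, he, rfl⟩
      simpa using he
    · rw [Set.ncard_coe_finset]; exact Finset.card_image_le
  have hfin : (Set.range c).Finite := (Set.finite_Iic E.card).subset (by rintro _ ⟨g, rfl⟩; exact hc g)
  obtain ⟨g, hg⟩ : ∃ g, ∀ g', c g' ≤ c g := by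
    obtain ⟨_, ⟨g, rfl⟩, hmax⟩ := Set.exists_max_image _ id hfin (Set.range_nonempty c)
    exact ⟨g, fun g' => hmax _ ⟨g', rfl⟩⟩
  refine ⟨g, ?_⟩
  have hEc : (0 : ℝ) < E.card := by exact_mod_cast hE.card_pos
  rw [← le_div_iff₀ hEc]
  apply csSup_le
  · obtain ⟨F, hF⟩ := hAmen
    exact ⟨_, F, hF, rfl⟩
  · rintro _ ⟨F, hF, rfl⟩
    exact aux_folner_bound F hF J E hE _ hg

lemma aux_compat_cont {Y : Type} [TopologicalSpace Y] (ρ : Y → Y → ℝ) (h : IsCompatMetric ρ) :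
    Continuous fun p : Y × Y => ρ p.1 p.2 := by
  obtain ⟨h0, hs, ht, hn⟩ := h
  rw [continuous_iff_continuousAt]
  rintro ⟨x, y⟩
  rw [ContinuousAt, Metric.tendsto_nhds]
  intro ε hε
  have hx : {z | ρ x z < ε / 2} ∈ 𝓝 x := (hn x _).mpr ⟨ε / 2, by positivity, Subset.rfl⟩
  have hy : {z | ρ y z < ε / 2} ∈ 𝓝 y := (hn y _).mpr ⟨ε / 2, by positivity, Subset.rfl⟩
  filter_upwards [prod_mem_nhds hx hy] with ⟨a, b⟩ ⟨ha, hb⟩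
  change ρ x a < ε / 2 at ha
  change ρ y b < ε / 2 at hb
  simp only [Real.dist_eq]
  rw [abs_lt]
  have e1 := ht x a y
  have e2 := ht a b y
  have e3 := ht a x b
  have e4 := ht x y b
  have e5 := hs b y
  have e6 := hs a x
  constructor <;> linarith

lemma aux_compat_eps {Y : Type} [TopologicalSpace Y] [CompactSpace Y] (ρ : Y → Y → ℝ)
    (h : IsCompatMetric ρ) (q : Y × Y → ℝ) (hq : Continuous q) (hq0 : ∀ x, q (x, x) = 0)
    (α : ℝ) (hα : 0 < α) : ∃ ε > 0, ∀ x y, ρ x y ≤ ε → q (x, y) < α := by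
  have hcont := aux_compat_cont ρ h
  have hnn : ∀ x y, 0 ≤ ρ x y := by
    intro x y
    have h1 := h.2.2.1 x y x
    have h2 := h.2.1 x y
    have h3 := (h.1 x x).mpr rfl
    linarith
  have hC : IsCompact {p : Y × Y | α ≤ q p} := (isClosed_le continuous_const hq).isCompact
  by_cases hne : {p : Y × Y | α ≤ q p}.Nonempty
  · obtain ⟨⟨a, b⟩, hab, hmin⟩ := hC.exists_isMinOn hne hcont.continuousOn
    have hpos : 0 < ρ a b := by
      refine lt_of_le_of_ne (hnn a b) fun h0 => ?_
      have := (h.1 a b).mp h0.symm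
      subst this
      have hab' : α ≤ q (a, a) := hab
      rw [hq0] at hab'
      linarith
    refine ⟨ρ a b / 2, by positivity, fun x y hxy => ?_⟩
    by_contra hcon
    have := hmin (show (x, y) ∈ {p : Y × Y | α ≤ q p} from not_lt.mp hcon)
    have : ρ a b ≤ ρ x y := this
    linarith
  · refine ⟨1, one_pos, fun x y _ => ?_⟩
    by_contra hcon
    exact hne ⟨(x, y), not_lt.mp hcon⟩

lemma aux_cube_sep {k : ℕ} {P : Type} [MetricSpace P] (e : (Fin k → ℝ) → P) (he : Continuous e)
    (hi : InjOn e (Icc 0 1)) : ∃ α > 0, ∀ a ∈ Icc (0 : Fin k → ℝ) 1, ∀ b ∈ Icc (0 : Fin k → ℝ) 1,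
      ∀ i, a i = 0 → b i = 1 → α ≤ dist (e a) (e b) := by
  let C : Set ((Fin k → ℝ) × (Fin k → ℝ)) := (Icc 0 1 ×ˢ Icc 0 1) ∩ {p | 1 ≤ dist p.1 p.2}
  have hC : IsCompact C := (isCompact_Icc.prod isCompact_Icc).inter_right
    (isClosed_le continuous_const continuous_dist)
  have hmem : ∀ a ∈ Icc (0 : Fin k → ℝ) 1, ∀ b ∈ Icc (0 : Fin k → ℝ) 1,
      ∀ i, a i = 0 → b i = 1 → (a, b) ∈ C := by
    intro a ha b hb i h0 h1
    refine ⟨⟨ha, hb⟩, ?_⟩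
    have := dist_le_pi_dist a b i
    rw [h0, h1, Real.dist_eq] at this
    norm_num at this
    exact this
  by_cases hne : C.Nonempty
  · obtain ⟨⟨a, b⟩, hab, hmin⟩ := hC.exists_isMinOn hne
      (f := fun p => dist (e p.1) (e p.2)) (by fun_prop)
    refine ⟨dist (e a) (e b), ?_, fun a' ha b' hb i h0 h1 => hmin (hmem a' ha b' hb i h0 h1)⟩
    rw [gt_iff_lt, dist_pos]
    intro heq
    have this : a = b := hi hab.1.1 hab.1.2 heq
    subst this
    have h2 : (1 : ℝ) ≤ dist a a := hab.2
    rw [dist_self] at h2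
    linarith
  · exact ⟨1, one_pos, fun a ha b hb i h0 h1 => absurd ⟨_, hmem a ha b hb i h0 h1⟩ hne⟩

theorem stmt14 {G : Type} [Group G] [Countable G] [Infinite G]
    (hAmen : ∃ F : ℕ → Finset G, IsFolner F)
    (P : Type) [MetricSpace P] [CompactSpace P] [Nonempty P] (hP : IsPolyhedron P)
    (X : Set (G → P)) (hXcl : IsClosed X)
    (hXinv : ∀ (g : G), ∀ x ∈ X, shift g x ∈ X)
    (J : Set G) (x₀ : G → P) (hx₀ : x₀ ∈ X)
    (W : G → Set P)
    (hWsub : {x : G → P | ∀ g, x g ∈ W g} ⊆ X)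
    (hWx₀ : ∃ w : G → P, (∀ g, w g ∈ W g) ∧ ∀ g ∉ J, w g = x₀ g)
    (c : ℝ) (hc : 0 < c)
    (hf : ∀ g ∈ J, ∃ f : P → P, Continuous f ∧ (∀ p, f p ∈ W g) ∧
      ∀ p q : P, dist p q ≤ c * dist (f p) (f q)) :
    ∀ (ρ : (G → P) → (G → P) → ℝ), IsCompatMetric ρ →
      ∀ (F : ℕ → Finset G) (hF : IsFolner F),
        ENNReal.ofReal (upperDensity J) * topDim P ≤ mdimWith X ρ F hF.1 := by
  classical
  intro ρ hρ F hF
  obtain ⟨w, hwW, -⟩ := hWx₀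
  obtain ⟨k, hkdim, e, hec, hei⟩ := aux_poly P hP
  have htop : topDim P ≤ k := sInf_le ⟨k, rfl, hkdim⟩
  obtain ⟨α, hα, hsep⟩ := aux_cube_sep e hec hei
  obtain ⟨ε, hε, hρε⟩ := aux_compat_eps ρ hρ (fun p => c * dist (p.1 1) (p.2 1)) (by fun_prop)
    (by simp) α hα
  refine le_trans (mul_le_mul_right htop _) ?_
  unfold mdimWith
  refine le_trans ?_ (le_iSup₂ (f := fun (ε : ℝ) (_ : 0 < ε) => Filter.atTop.limsup fun n =>
    dimEps X (fun x y => (F n).sup' (hF.1 n) fun g => ρ (shift g x.1) (shift g y.1)) ε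
      / ((F n).card : ENNReal)) ε hε)
  refine Filter.le_limsup_of_frequently_le (Frequently.of_forall fun n => ?_)
  have hFc : (F n).card ≠ 0 := (hF.1 n).card_pos.ne'
  rw [ENNReal.le_div_iff_mul_le (Or.inl (by exact_mod_cast hFc)) (Or.inl (by simp))]
  obtain ⟨g, hg⟩ := aux_density hAmen J (F n) (hF.1 n)
  let B : Finset G := ((F n).image fun e => e * g).filter (· ∈ J)
  have hB : (J ∩ {h | ∃ e ∈ F n, h = e * g}).ncard = B.card := by
    rw [← Set.ncard_coe_finset]
    congr 1
    ext h
    constructor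
    · rintro ⟨hJ, e, he, rfl⟩
      exact Finset.mem_coe.mpr (Finset.mem_filter.mpr ⟨Finset.mem_image.mpr ⟨e, he, rfl⟩, hJ⟩)
    · intro hh
      obtain ⟨h1, h2⟩ := Finset.mem_filter.mp (Finset.mem_coe.mp hh)
      obtain ⟨e, he, hee⟩ := Finset.mem_image.mp h1
      exact ⟨h2, e, he, hee.symm⟩
  rw [hB] at hg
  have hlow : ((B.card * k : ℕ) : ENNReal) ≤
      dimEps X (fun x y => (F n).sup' (hF.1 n) fun g => ρ (shift g x.1) (shift g y.1)) ε := by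
    apply le_sInf
    rintro _ ⟨Q, _, fQ, _, hfQ, hinj, rfl⟩
    apply le_sInf
    rintro _ ⟨m, rfl, hm⟩
    have hfJ : ∀ h : B, ∃ f : P → P, Continuous f ∧ (∀ p, f p ∈ W h) ∧
      ∀ p q : P, dist p q ≤ c * dist (f p) (f q) := fun h => hf h (Finset.mem_filter.mp h.2).2
    choose f hfc hfW hfd using hfJ
    let Φ : (B × Fin k → ℝ) → (G → P) := fun a h =>
      if hh : h ∈ B then f ⟨h, hh⟩ (e fun i => a (⟨h, hh⟩, i)) else w h
    have hΦX : ∀ a, shift g (Φ a) ∈ X := by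
      intro a
      apply hXinv
      apply hWsub
      intro h
      by_cases hh : h ∈ B
      · simp only [Φ, hh, dif_pos]; exact hfW ⟨h, hh⟩ _
      · simp only [Φ, hh, dif_neg, not_false_eq_true]; exact hwW h
    have hΦc : Continuous fun a => shift g (Φ a) := by
      apply continuous_pi
      intro h
      change Continuous fun a => Φ a (h * g)
      by_cases hh : h * g ∈ B
      · simp only [Φ, hh, dif_pos]
        exact (hfc _).comp (hec.comp (by fun_prop))
      · simp only [Φ, hh, dif_neg, not_false_eq_true]
        exact continuous_const
    have hcard := aux_lebesgue (ι := B × Fin k) (fun a => fQ ⟨_, hΦX a⟩)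
      (hfQ.comp (hΦc.subtype_mk _)) (by
        rintro a ha b hb ⟨h, i⟩ h0 h1 heq
        have hle := hinj _ _ heq
        obtain ⟨hh1, hh2⟩ := Finset.mem_filter.mp h.2
        obtain ⟨e', he', hee⟩ := Finset.mem_image.mp hh1
        have h3 := (Finset.le_sup' (fun g' => ρ (shift g' (shift g (Φ a))) (shift g' (shift g (Φ b)))) he').trans hle
        have h4 := hρε _ _ h3
        have h5 : ∀ a, shift e' (shift g (Φ a)) 1 = f h (e fun i => a (h, i)) := by
          intro a
          change Φ a (1 * e' * g) = _
          rw [one_mul]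
          have hm : e' * g ∈ B := by rw [hee]; exact h.2
          simp only [Φ, hm, dif_pos]
          have : (⟨e' * g, hm⟩ : B) = h := Subtype.ext hee
          rw [this]
        simp only [h5] at h4
        have h6 := hfd h (e fun i => a (h, i)) (e fun i => b (h, i))
        have h7 := hsep (fun i => a (h, i)) ⟨fun i => ha.1 _, fun i => ha.2 _⟩
          (fun i => b (h, i)) ⟨fun i => hb.1 _, fun i => hb.2 _⟩ i h0 h1
        linarith) m hm
    rw [Fintype.card_prod, Fintype.card_coe, Fintype.card_fin] at hcard
    exact_mod_cast hcard
  refine le_trans ?_ hlow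
  have h1 : ENNReal.ofReal (upperDensity J) * ((F n).card : ENNReal) ≤ (B.card : ENNReal) := by
    have := ENNReal.ofReal_le_ofReal hg
    rwa [ENNReal.ofReal_mul' (by positivity), ENNReal.ofReal_natCast, ENNReal.ofReal_natCast] at this
  calc ENNReal.ofReal (upperDensity J) * (k : ENNReal) * ((F n).card : ENNReal)
      = (ENNReal.ofReal (upperDensity J) * ((F n).card : ENNReal)) * k := by ring
    _ ≤ B.card * k := by gcongr
    _ = _ := by push_cast; rfl
end
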